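/- arXiv:math/0507388 — 6 statements merged into one kernel-verified Lean document; each statement's English description precedes it below -/
import Mathlib

section
/- Suppose n = ∞. Then: (i) every G-stable ℚ-subspace W' of a homotopy invariant smooth representation W of G is homotopy invariant, as is the quotient representation W/W'; (ii) if W is a smooth representation of G and W' ⊆ W is a G-stable subspace such that both W' and W/W' are homotopy invariant, then W is homotopy invariant. (In other words, the homotopy invariant representations form a Serre subcategory of the category of smooth representations of G.) -/
universe u

/-- The topology of pointwise convergence on `Aut(F/k)`, where `F` carries the
discrete topology: a base of open neighbourhoods of the identity is given by
the pointwise stabilizers of finite subsets of `F`. -/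
def autTop (k F : Type*) [Field k] [Field F] [Algebra k F] :
    TopologicalSpace (F ≃ₐ[k] F) :=
  TopologicalSpace.induced (fun g (x : F) => g x)
    (@Pi.topologicalSpace F (fun _ => F) (fun _ => ⊥))

section Reps

variable {k F : Type*} [Field k] [Field F] [Algebra k F]
variable {W : Type u} [AddCommGroup W] [Module ℚ W]

/-- The subspace of vectors fixed by a subgroup `U` of `G = Aut(F/k)`. -/
def fixedSubmodule (ρ : Representation ℚ (F ≃ₐ[k] F) W)
    (U : Subgroup (F ≃ₐ[k] F)) : Submodule ℚ W where
  carrier := {w | ∀ g ∈ U, ρ g w = w}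
  add_mem' := by
    intro a b ha hb g hg
    rw [map_add, ha g hg, hb g hg]
  zero_mem' := fun g _ => map_zero _
  smul_mem' := by
    intro c w hw g hg
    rw [map_smul, hw g hg]

/-- A representation of `G = Aut(F/k)` is smooth if the stabilizer of every
vector is open. -/
def IsSmoothRep (ρ : Representation ℚ (F ≃ₐ[k] F) W) : Prop :=
  ∀ w : W, @IsOpen _ (autTop k F) {g : F ≃ₐ[k] F | ρ g w = w}

/-- A representation of `G = Aut(F/k)` is admissible if it is smooth and the
fixed subspace of every open subgroup is finite-dimensional over `ℚ`. -/
def IsAdmissibleRep (ρ : Representation ℚ (F ≃ₐ[k] F) W) : Prop :=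
  IsSmoothRep ρ ∧ ∀ U : Subgroup (F ≃ₐ[k] F),
    @IsOpen _ (autTop k F) (U : Set (F ≃ₐ[k] F)) →
      FiniteDimensional ℚ ↥(fixedSubmodule ρ U)

/-- `L'` is a purely transcendental extension of the intermediate field `L`:
`L'` is generated over `L` by a set of algebraically independent elements. -/
def IsPurelyTranscendentalExt (L L' : IntermediateField k F) : Prop :=
  ∃ s : Set F, AlgebraicIndependent ↥L (Subtype.val : s → F) ∧
    (IntermediateField.adjoin ↥L s).restrictScalars k = L'

/-- A representation of `G = Aut(F/k)` is homotopy invariant if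
`W^{G_{F/L}} = W^{G_{F/L'}}` whenever `L'/L` is a purely transcendental
subextension of `F/k`. -/
def IsHomotopyInvariantRep (ρ : Representation ℚ (F ≃ₐ[k] F) W) : Prop :=
  ∀ L L' : IntermediateField k F, IsPurelyTranscendentalExt L L' →
    fixedSubmodule ρ L.fixingSubgroup = fixedSubmodule ρ L'.fixingSubgroup

/-- The subrepresentation on a `G`-stable subspace. -/
def subRep (ρ : Representation ℚ (F ≃ₐ[k] F) W) (W' : Submodule ℚ W)
    (h : ∀ g : F ≃ₐ[k] F, ∀ w ∈ W', ρ g w ∈ W') :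
    Representation ℚ (F ≃ₐ[k] F) ↥W' where
  toFun g := (ρ g).restrict (p := W') (q := W') (fun w hw => h g w hw)
  map_one' := by
    apply LinearMap.ext
    intro w
    apply Subtype.ext
    simp [LinearMap.restrict_apply]
  map_mul' g₁ g₂ := by
    apply LinearMap.ext
    intro w
    apply Subtype.ext
    simp [LinearMap.restrict_apply]

/-- The quotient representation on `W ⧸ W'` for a `G`-stable subspace `W'`. -/
def quotRep (ρ : Representation ℚ (F ≃ₐ[k] F) W) (W' : Submodule ℚ W)
    (h : ∀ g : F ≃ₐ[k] F, ∀ w ∈ W', ρ g w ∈ W') :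
    Representation ℚ (F ≃ₐ[k] F) (W ⧸ W') where
  toFun g := W'.mapQ W' (ρ g) (fun w hw => h g w hw)
  map_one' := by
    apply LinearMap.ext
    intro x
    obtain ⟨y, rfl⟩ := Submodule.Quotient.mk_surjective W' x
    simp [Submodule.mapQ_apply]
  map_mul' g₁ g₂ := by
    apply LinearMap.ext
    intro x
    obtain ⟨y, rfl⟩ := Submodule.Quotient.mk_surjective W' x
    simp [Submodule.mapQ_apply]

end Reps

/-- An automorphism of a base field extends to an algebraically closed overfield, compatibly with
any two transcendence bases having the same index type. -/
theorem exists_ringEquiv_extending {R F ι : Type*} [Field R] [Field F] [IsAlgClosed F]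
    [Algebra R F] {v w : ι → F} (hv : IsTranscendenceBasis R v) (hw : IsTranscendenceBasis R w)
    (σ : R ≃+* R) :
    ∃ g : F ≃+* F, (∀ r, g (algebraMap R F r) = algebraMap R F (σ r)) ∧ ∀ i, g (v i) = w i := by
  have := IsAlgClosed.isAlgClosure_of_transcendence_basis v hv
  have := IsAlgClosed.isAlgClosure_of_transcendence_basis w hw
  let e : Algebra.adjoin R (Set.range v) ≃+* Algebra.adjoin R (Set.range w) :=
    hv.1.aevalEquiv.symm.toRingEquiv.trans
      ((MvPolynomial.mapEquiv ι σ).trans hw.1.aevalEquiv.toRingEquiv)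
  have key : ∀ p : MvPolynomial ι R, IsAlgClosure.equivOfEquiv F F e (MvPolynomial.aeval v p) =
      MvPolynomial.aeval w (MvPolynomial.map (σ : R →+* R) p) := by
    intro p
    rw [← hv.1.algebraMap_aevalEquiv, IsAlgClosure.equivOfEquiv_algebraMap,
      ← hw.1.algebraMap_aevalEquiv]
    simp [e]
  refine ⟨IsAlgClosure.equivOfEquiv F F e, fun r => ?_, fun i => ?_⟩
  · simpa using key (MvPolynomial.C r)
  · simpa using key (MvPolynomial.X i)

/-- Any two transcendental elements of an algebraically closed extension are conjugate. -/
theorem Transcendental.exists_algEquiv_apply_eq {K F : Type*} [Field K] [Field F] [IsAlgClosed F]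
    [Algebra K F] {x y : F} (hx : Transcendental K x) (hy : Transcendental K y) :
    ∃ g : F ≃ₐ[K] F, g x = y := by
  classical
  obtain ⟨s, hxs, hs⟩ := exists_isTranscendenceBasis_superset (R := K) (s := {x})
    (by simpa [AlgebraicIndepOn, algebraicIndependent_unique_type_iff] using hx)
  obtain ⟨t, hyt, ht⟩ := exists_isTranscendenceBasis_superset (R := K) (s := {y})
    (by simpa [AlgebraicIndepOn, algebraicIndependent_unique_type_iff] using hy)
  rw [Set.singleton_subset_iff] at hxs hyt
  obtain ⟨e⟩ := Cardinal.eq.1 (hs.cardinalMk_eq ht)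
  let e' : s ≃ t := e.trans (Equiv.swap (e ⟨x, hxs⟩) ⟨y, hyt⟩)
  obtain ⟨g, hg, hgs⟩ := exists_ringEquiv_extending hs
    (ht.comp_equiv e') (RingEquiv.refl K)
  refine ⟨AlgEquiv.ofRingEquiv (f := g) (by simpa using hg), ?_⟩
  exact (hgs ⟨x, hxs⟩).trans (by simp [e'])

/-- Any two roots of a minimal polynomial in an algebraically closed, not necessarily algebraic,
extension are conjugate. -/
theorem IsAlgebraic.exists_algEquiv_apply_eq {K F : Type*} [Field K] [Field F] [IsAlgClosed F]
    [Algebra K F] {x y : F} (hx : IsAlgebraic K x)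
    (hy : Polynomial.aeval y (minpoly K x) = 0) :
    ∃ g : F ≃ₐ[K] F, g x = y := by
  have hy' : IsAlgebraic K y := ⟨_, minpoly.ne_zero hx.isIntegral, hy⟩
  let C := algebraicClosure K F
  let x' : C := ⟨x, mem_algebraicClosure_iff.2 hx⟩
  let y' : C := ⟨y, mem_algebraicClosure_iff.2 hy'⟩
  have : IsAlgClosure K C := inferInstance
  have : Normal K C := IsAlgClosure.normal K C
  obtain ⟨σ, hσ⟩ := minpoly.exists_algEquiv_of_root' (K := K) (L := C) (x := y') (y := x')
    (Algebra.IsAlgebraic.isAlgebraic _) (by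
      apply (algebraMap C F).injective
      rw [← Polynomial.aeval_algebraMap_apply, map_zero,
        ← minpoly.algebraMap_eq (algebraMap C F).injective]
      exact hy)
  obtain ⟨s, hs⟩ := exists_isTranscendenceBasis C F
  obtain ⟨g, hg, -⟩ := exists_ringEquiv_extending hs hs σ.toRingEquiv
  refine ⟨AlgEquiv.ofRingEquiv (f := g) fun r => ?_, ?_⟩
  · simpa [← IsScalarTower.algebraMap_apply] using hg (algebraMap K C r)
  · exact (hg x').trans (congrArg (algebraMap C F) hσ)

open AlgebraicIndependent in
/-- The set of elements of `F` algebraic over `k(A)`, as a matroid closure. -/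
abbrev algSpan (k : Type*) {F : Type*} [Field k] [Field F] [Algebra k F] (A : Set F) : Set F :=
  (matroid k F).closure A

section Conjugation

variable {k F : Type*} [Field k] [Field F] [Algebra k F]

theorem mem_algSpan_iff {A : Set F} {x : F} :
    x ∈ algSpan k A ↔ IsAlgebraic (IntermediateField.adjoin k A) x := by
  rw [algSpan, AlgebraicIndependent.matroid_closure_eq, SetLike.mem_coe,
    Subalgebra.mem_algebraicClosure, IntermediateField.isAlgebraic_adjoin_iff]

theorem notMem_algSpan_union_iff {A B : Set F} {x : F} :
    x ∉ algSpan k (A ∪ B) ↔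
      Transcendental (Algebra.adjoin (IntermediateField.adjoin k A) B) x := by
  rw [mem_algSpan_iff, ← IntermediateField.adjoin_adjoin_left, Transcendental, not_iff_not,
    ← IntermediateField.isAlgebraic_adjoin_iff]
  rfl

theorem algSpan_mono {A B : Set F} (h : A ⊆ B) : algSpan k A ⊆ algSpan k B :=
  Matroid.closure_subset_closure _ h

theorem fixes_adjoin {A : Set F} {g : F ≃ₐ[k] F} (hg : g ∈ fixingSubgroup (F ≃ₐ[k] F) A)
    {y : F} (hy : y ∈ IntermediateField.adjoin k A) : g y = y := by
  have : IntermediateField.adjoin k A ≤ IntermediateField.fixedField (Subgroup.zpowers g) := by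
    rw [IntermediateField.adjoin_le_iff]
    intro a ha
    have : Subgroup.zpowers g ≤ MulAction.stabilizer (F ≃ₐ[k] F) a := by
      rw [Subgroup.zpowers_le]
      exact (mem_fixingSubgroup_iff _).1 hg a ha
    exact fun h => this h.2
  exact this hy ⟨g, Subgroup.mem_zpowers g⟩

/-- A `k(A)`-automorphism, seen as a `k`-automorphism fixing `A`. -/
theorem restrictScalars_mem_fixingSubgroup {A : Set F}
    (g : F ≃ₐ[IntermediateField.adjoin k A] F) :
    g.restrictScalars k ∈ fixingSubgroup (F ≃ₐ[k] F) A :=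
  (mem_fixingSubgroup_iff _).2 fun a ha =>
    g.commutes ⟨a, IntermediateField.subset_adjoin k A ha⟩

theorem map_notMem_algSpan {A : Set F} {g : F ≃ₐ[k] F} (hg : g ∈ fixingSubgroup (F ≃ₐ[k] F) A)
    {x : F} (hx : x ∉ algSpan k A) : g x ∉ algSpan k A := by
  let f : F ≃ₐ[IntermediateField.adjoin k A] F :=
    AlgEquiv.ofRingEquiv (f := g.toRingEquiv) fun r => fixes_adjoin hg r.2
  rw [mem_algSpan_iff] at hx ⊢
  exact fun h => hx ((isAlgebraic_algHom_iff f.toAlgHom f.injective).1 h)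

theorem notMem_algSpan_exchange {A : Set F} {x y : F} (hx : x ∉ algSpan k A)
    (hy : y ∉ algSpan k (insert x A)) : x ∉ algSpan k (insert y A) :=
  fun h => hy (Matroid.mem_closure_insert hx h)

theorem exists_notMem_algSpan (hn : ∃ x : ℕ → F, IsTranscendenceBasis k x) {A : Set F}
    (hA : A.Finite) : ∃ u, u ∉ algSpan k A := by
  by_contra! h
  have hs : (AlgebraicIndependent.matroid k F).Spanning A :=
    ⟨Set.eq_univ_of_forall h, Set.subset_univ A⟩
  have := AlgebraicIndependent.matroid_spanning_iff.1 hs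
  obtain ⟨x, hx⟩ := hn
  have h1 := Algebra.IsAlgebraic.trdeg_le_cardinalMk k A
  have h2 := hx.lift_cardinalMk_eq_trdeg
  simp only [Cardinal.mk_nat, Cardinal.lift_aleph0] at h2
  have := hA.lt_aleph0
  rw [Cardinal.lift_id'.{0}] at h2
  exact absurd (h2.trans_le h1) (not_le.2 this)

theorem inv_mul_mem_of_apply_eq {A : Set F} {x : F} {f g : F ≃ₐ[k] F}
    (hf : f ∈ fixingSubgroup (F ≃ₐ[k] F) A) (hg : g ∈ fixingSubgroup (F ≃ₐ[k] F) A)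
    (h : f x = g x) : f⁻¹ * g ∈ fixingSubgroup (F ≃ₐ[k] F) (insert x A) := by
  rw [mem_fixingSubgroup_iff]
  rintro a (rfl | ha)
  · rw [mul_smul, inv_smul_eq_iff]
    exact h.symm
  · exact (mem_fixingSubgroup_iff _).1 (mul_mem (inv_mem hf) hg) a ha

theorem fixingSubgroup_insert_apply_le {A : Set F} {x : F} {h : F ≃ₐ[k] F}
    (hA : h ∈ fixingSubgroup (F ≃ₐ[k] F) A) {H : Subgroup (F ≃ₐ[k] F)} (hH : h ∈ H)
    (hx : fixingSubgroup (F ≃ₐ[k] F) (insert x A) ≤ H) :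
    fixingSubgroup (F ≃ₐ[k] F) (insert (h x) A) ≤ H := by
  intro g hg
  rw [mem_fixingSubgroup_iff, Set.forall_mem_insert] at hg
  have hgA : g ∈ fixingSubgroup (F ≃ₐ[k] F) A := (mem_fixingSubgroup_iff _).2 hg.2
  have := hx (inv_mul_mem_of_apply_eq (x := x) hA (mul_mem hgA hA) hg.1.symm)
  have h2 := mul_mem (mul_mem hH this) (inv_mem hH)
  simpa [mul_assoc] using h2

theorem exists_finite_subset_adjoin {E T : Set F} (hT : T.Finite)
    (h : T ⊆ IntermediateField.adjoin k E) :
    ∃ D ⊆ E, D.Finite ∧ T ⊆ IntermediateField.adjoin k D := by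
  induction T, hT using Set.Finite.induction_on with
  | empty => exact ⟨∅, Set.empty_subset _, Set.finite_empty, Set.empty_subset _⟩
  | @insert a T _ _ ih =>
    rw [Set.insert_subset_iff] at h
    obtain ⟨D, hDE, hD, hTD⟩ := ih h.2
    obtain ⟨D', hDE', haD⟩ := IntermediateField.exists_finset_of_mem_adjoin h.1
    refine ⟨D' ∪ D, Set.union_subset hDE' hDE, D'.finite_toSet.union hD, Set.insert_subset ?_ ?_⟩
    · exact IntermediateField.adjoin.mono k _ _ Set.subset_union_left haD
    · exact hTD.trans (IntermediateField.adjoin.mono k _ _ Set.subset_union_right)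

variable [IsAlgClosed F]

theorem exists_conj_of_notMem_algSpan {A : Set F} {x y : F} (hx : x ∉ algSpan k A)
    (hy : y ∉ algSpan k A) : ∃ g ∈ fixingSubgroup (F ≃ₐ[k] F) A, g x = y := by
  rw [mem_algSpan_iff] at hx hy
  obtain ⟨g, hg⟩ := Transcendental.exists_algEquiv_apply_eq hx hy
  exact ⟨_, restrictScalars_mem_fixingSubgroup g, hg⟩

/-- Two independent elements can be exchanged by an automorphism. -/
theorem exists_swap_of_notMem_algSpan {A : Set F} {x y : F} (hx : x ∉ algSpan k A)
    (hy : y ∉ algSpan k (insert x A)) :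
    ∃ g ∈ fixingSubgroup (F ≃ₐ[k] F) A, g x = y ∧ g y = x := by
  classical
  rw [Set.insert_eq, Set.union_comm, notMem_algSpan_union_iff] at hy
  rw [mem_algSpan_iff] at hx
  have hxy : AlgebraicIndepOn (IntermediateField.adjoin k A) id {y, x} := by
    refine AlgebraicIndepOn.insert ?_ (by rwa [Set.image_id])
    exact algebraicIndependent_unique_type_iff.2 hx
  obtain ⟨s, hs, hbasis⟩ := exists_isTranscendenceBasis_superset hxy
  have hys : y ∈ s := hs (by simp)
  have hxs : x ∈ s := hs (by simp)
  obtain ⟨g, hg, hgs⟩ := exists_ringEquiv_extending hbasis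
    (hbasis.comp_equiv (Equiv.swap ⟨x, hxs⟩ ⟨y, hys⟩)) (RingEquiv.refl _)
  refine ⟨_, restrictScalars_mem_fixingSubgroup
    (AlgEquiv.ofRingEquiv (f := g) (by simpa using hg)), ?_, ?_⟩
  · exact (hgs ⟨x, hxs⟩).trans (by simp)
  · exact (hgs ⟨y, hys⟩).trans (by simp)

theorem exists_conj_of_mem_algSpan {A : Set F} {x y : F} (hx : x ∈ algSpan k A)
    (hy : Polynomial.aeval y (minpoly (IntermediateField.adjoin k A) x) = 0) :
    ∃ g ∈ fixingSubgroup (F ≃ₐ[k] F) A, g x = y := by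
  rw [mem_algSpan_iff] at hx
  obtain ⟨g, hg⟩ := IsAlgebraic.exists_algEquiv_apply_eq hx hy
  exact ⟨_, restrictScalars_mem_fixingSubgroup g, hg⟩

/-- The stabilizers of two independent elements over `k(A)` generate the stabilizer of `A`. -/
theorem fixingSubgroup_le_of_pair (hn : ∃ x : ℕ → F, IsTranscendenceBasis k x) {A : Set F}
    (hA : A.Finite) {x y : F} (hx : x ∉ algSpan k A) (hy : y ∉ algSpan k (insert x A))
    {H : Subgroup (F ≃ₐ[k] F)} (hHx : fixingSubgroup (F ≃ₐ[k] F) (insert x A) ≤ H)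
    (hHy : fixingSubgroup (F ≃ₐ[k] F) (insert y A) ≤ H) :
    fixingSubgroup (F ≃ₐ[k] F) A ≤ H := by
  intro g hg
  obtain ⟨u, hu⟩ := exists_notMem_algSpan hn ((hA.insert (g x)).insert x)
  have hux : u ∉ algSpan k (insert x A) :=
    fun h => hu (algSpan_mono (Set.insert_subset_insert (Set.subset_insert _ _)) h)
  have hugx : u ∉ algSpan k (insert (g x) A) := fun h => hu (algSpan_mono (Set.subset_insert _ _) h)
  obtain ⟨h, hh, rfl⟩ := exists_conj_of_notMem_algSpan hy hux
  have hhA := fixingSubgroup_antitone (F ≃ₐ[k] F) F (Set.subset_insert x A) hh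
  have hHu := fixingSubgroup_insert_apply_le hhA (hHx hh) hHy
  obtain ⟨f, hf, hfx⟩ := exists_conj_of_notMem_algSpan (notMem_algSpan_exchange hx hux)
    (notMem_algSpan_exchange (map_notMem_algSpan hg hx) hugx)
  have hfA := fixingSubgroup_antitone (F ≃ₐ[k] F) F (Set.subset_insert _ A) hf
  have := mul_mem (hHu hf) (hHx (inv_mul_mem_of_apply_eq hfA hg hfx))
  simpa using this

theorem exists_finite_fixingSubgroup_le_of_insert (hn : ∃ x : ℕ → F, IsTranscendenceBasis k x)
    {H : Subgroup (F ≃ₐ[k] F)} {E D : Set F} {x : F} (hE : fixingSubgroup (F ≃ₐ[k] F) E ≤ H)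
    (hDE : D ⊆ E) (hD : D.Finite) (hx : fixingSubgroup (F ≃ₐ[k] F) (insert x D) ≤ H) :
    ∃ C ⊆ E, C.Finite ∧ fixingSubgroup (F ≃ₐ[k] F) C ≤ H := by
  by_cases hxE : x ∈ algSpan k E
  · let p := minpoly (IntermediateField.adjoin k E) x
    obtain ⟨T, hTE, hT, hpT⟩ := exists_finite_subset_adjoin (k := k) (E := E)
      (T := Subtype.val '' (p.coeffs : Set (IntermediateField.adjoin k E)))
      (p.coeffs.finite_toSet.image _) (by rintro _ ⟨a, -, rfl⟩; exact a.2)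
    refine ⟨D ∪ T, Set.union_subset hDE hTE, hD.union hT, fun g hg => ?_⟩
    have hgD := fixingSubgroup_antitone (F ≃ₐ[k] F) F (Set.subset_union_left (s := D)) hg
    have hgT := fixingSubgroup_antitone (F ≃ₐ[k] F) F (Set.subset_union_right (s := D)) hg
    have hroot : Polynomial.aeval (g x) p = 0 := by
      have h0 : g (Polynomial.aeval x p) = 0 := by rw [minpoly.aeval, map_zero]
      rw [← h0, Polynomial.aeval_eq_sum_range, Polynomial.aeval_eq_sum_range, map_sum]
      refine Finset.sum_congr rfl fun i _ => ?_
      rw [Algebra.smul_def, Algebra.smul_def, map_mul, map_pow]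
      congr 1
      by_cases hc : p.coeff i = 0
      · simp [hc]
      · exact (fixes_adjoin hgT (hpT ⟨_, Polynomial.coeff_mem_coeffs hc, rfl⟩)).symm
    obtain ⟨h, hh, hhx⟩ := exists_conj_of_mem_algSpan hxE hroot
    have hhD := fixingSubgroup_antitone (F ≃ₐ[k] F) F hDE hh
    have := mul_mem (hE hh) (hx (inv_mul_mem_of_apply_eq hhD hgD hhx))
    simpa using this
  · obtain ⟨y, hyE, hyx⟩ : ∃ y, y ∉ algSpan k E ∧ y ∉ algSpan k (insert x D) := by
      by_cases hED : E ⊆ algSpan k D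
      · obtain ⟨y, hy⟩ := exists_notMem_algSpan hn (hD.insert x)
        refine ⟨y, fun h => hy (algSpan_mono (Set.subset_insert x D) ?_), hy⟩
        exact Matroid.closure_subset_closure_of_subset_closure hED h
      · obtain ⟨a, haE, haD⟩ := Set.not_subset.1 hED
        have hxa : x ∉ algSpan k (insert a D) :=
          fun h => hxE (algSpan_mono (Set.insert_subset haE hDE) h)
        have hax := notMem_algSpan_exchange haD hxa
        rw [mem_algSpan_iff] at hax hxE
        refine ⟨a + x, fun h => hxE ?_, fun h => hax ?_⟩
        · rw [mem_algSpan_iff] at h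
          simpa using h.sub (isAlgebraic_algebraMap
            (⟨a, IntermediateField.subset_adjoin k E haE⟩ : IntermediateField.adjoin k E))
        · rw [mem_algSpan_iff] at h
          simpa using h.sub (isAlgebraic_algebraMap
            (⟨x, IntermediateField.subset_adjoin k _ (Set.mem_insert x D)⟩ :
              IntermediateField.adjoin k (insert x D)))
    obtain ⟨h, hh, rfl⟩ := exists_conj_of_notMem_algSpan hxE hyE
    have hhD := fixingSubgroup_antitone (F ≃ₐ[k] F) F hDE hh
    exact ⟨D, hDE, hD, fixingSubgroup_le_of_pair hn hD
      (fun h => hxE (algSpan_mono hDE h)) hyx hx (fixingSubgroup_insert_apply_le hhD (hE hh) hx)⟩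

/-- An open subgroup containing the stabilizer of `E` contains the stabilizer of a finite subset
of `E`. -/
theorem exists_finite_fixingSubgroup_le (hn : ∃ x : ℕ → F, IsTranscendenceBasis k x)
    {H : Subgroup (F ≃ₐ[k] F)} {S : Set F} (hS : S.Finite) :
    ∀ {E C : Set F}, fixingSubgroup (F ≃ₐ[k] F) E ≤ H → C ⊆ E → C.Finite →
      fixingSubgroup (F ≃ₐ[k] F) (C ∪ S) ≤ H →
      ∃ D ⊆ E, D.Finite ∧ fixingSubgroup (F ≃ₐ[k] F) D ≤ H := by
  induction S, hS using Set.Finite.induction_on with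
  | empty => exact fun _ hCE hC h => ⟨_, hCE, hC, by simpa using h⟩
  | @insert x S _ _ ih =>
    intro E C hE hCE hC h
    obtain ⟨D, hDE, hD, hDH⟩ := ih (E := insert x E) (C := insert x C)
      ((fixingSubgroup_antitone _ _ (Set.subset_insert x E)).trans hE)
      (Set.insert_subset_insert hCE) (hC.insert x)
      (by rwa [Set.insert_union, ← Set.union_insert])
    refine exists_finite_fixingSubgroup_le_of_insert hn (D := D \ {x}) (x := x) hE ?_ hD.sdiff ?_
    · rw [Set.sdiff_subset_iff]
      simpa using hDE
    · refine le_trans (fixingSubgroup_antitone _ _ ?_) hDH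
      simp

end Conjugation

section Fixed

variable {k F : Type*} [Field k] [Field F] [Algebra k F]
variable {W : Type u} [AddCommGroup W] [Module ℚ W]

/-- The stabilizer of a vector, as a subgroup. -/
def vecStab (ρ : Representation ℚ (F ≃ₐ[k] F) W) (w : W) : Subgroup (F ≃ₐ[k] F) where
  carrier := {g | ρ g w = w}
  one_mem' := by simp
  mul_mem' := by
    intro a b (ha : ρ a w = w) (hb : ρ b w = w)
    change ρ (a * b) w = w
    rw [map_mul, Module.End.mul_apply, hb, ha]
  inv_mem' := by
    intro a (ha : ρ a w = w)
    change ρ a⁻¹ w = w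
    conv_lhs => rw [← ha]
    exact ρ.inv_self_apply a w

theorem mem_vecStab {ρ : Representation ℚ (F ≃ₐ[k] F) W} {w : W} {g : F ≃ₐ[k] F} :
    g ∈ vecStab ρ w ↔ ρ g w = w := Iff.rfl

theorem mem_fixedSubmodule_iff {ρ : Representation ℚ (F ≃ₐ[k] F) W} {w : W}
    {U : Subgroup (F ≃ₐ[k] F)} : w ∈ fixedSubmodule ρ U ↔ U ≤ vecStab ρ w := Iff.rfl

theorem IsSmoothRep.exists_finite {ρ : Representation ℚ (F ≃ₐ[k] F) W} (hρ : IsSmoothRep ρ)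
    (w : W) : ∃ S : Set F, S.Finite ∧ fixingSubgroup (F ≃ₐ[k] F) S ≤ vecStab ρ w := by
  let : TopologicalSpace F := ⊥
  obtain ⟨t, ht, hts⟩ := isOpen_induced_iff.1 (hρ w)
  have h1 : (fun x : F => (1 : F ≃ₐ[k] F) x) ∈ t := by
    change (1 : F ≃ₐ[k] F) ∈ (fun (g : F ≃ₐ[k] F) (x : F) => g x) ⁻¹' t
    rw [hts]
    simp
  obtain ⟨I, u, hu, hI⟩ := isOpen_pi_iff.1 ht _ h1
  refine ⟨I, I.finite_toSet, fun g hg => ?_⟩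
  have : g ∈ (fun (g : F ≃ₐ[k] F) (x : F) => g x) ⁻¹' t := by
    refine hI fun a ha => ?_
    have hga : g a = a := (mem_fixingSubgroup_iff _).1 hg a ha
    simpa [hga] using (hu a ha).2
  rwa [hts] at this

theorem fixingSubgroup_adjoin_eq (A : Set F) :
    (IntermediateField.adjoin k A).fixingSubgroup = fixingSubgroup (F ≃ₐ[k] F) A :=
  le_antisymm (fixingSubgroup_antitone _ _ (IntermediateField.subset_adjoin k A))
    fun _ hg => (mem_fixingSubgroup_iff _).2 fun _ hy => fixes_adjoin hg hy

theorem IsHomotopyInvariantRep.fixingSubgroup_le {ρ : Representation ℚ (F ≃ₐ[k] F) W}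
    (hρ : IsHomotopyInvariantRep ρ) {A : Set F} {x : F} (hx : x ∉ algSpan k A) {w : W}
    (hw : fixingSubgroup (F ≃ₐ[k] F) (insert x A) ≤ vecStab ρ w) :
    fixingSubgroup (F ≃ₐ[k] F) A ≤ vecStab ρ w := by
  have h := hρ (IntermediateField.adjoin k A) (IntermediateField.adjoin k (insert x A))
    ⟨{x}, algebraicIndependent_unique_type_iff.2 (by rwa [mem_algSpan_iff] at hx), by
      rw [IntermediateField.adjoin_adjoin_left, Set.union_comm, Set.insert_eq]⟩
  rw [fixingSubgroup_adjoin_eq, fixingSubgroup_adjoin_eq] at h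
  rw [← mem_fixedSubmodule_iff] at hw ⊢
  rwa [h]

theorem AlgebraicIndependent.notMem_algSpan {L : IntermediateField k F} {s : Set F}
    (hs : AlgebraicIndependent L (Subtype.val : s → F)) {A T : Set F} (hA : A ⊆ L) (hT : T ⊆ s)
    {x : F} (hxs : x ∈ s) (hxT : x ∉ T) : x ∉ algSpan k (A ∪ T) := by
  have h := hs.transcendental_adjoin (s := Subtype.val ⁻¹' T) (i := ⟨x, hxs⟩) hxT
  rw [Subtype.image_preimage_val, Set.inter_eq_right.2 hT, Transcendental,
    ← IntermediateField.isAlgebraic_adjoin_iff] at h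
  refine fun hx => h ?_
  have := algSpan_mono (Set.union_subset_union_left T hA) hx
  rw [mem_algSpan_iff, ← IntermediateField.restrictScalars_adjoin] at this
  exact this

/-- Averaging over a finite orbit. -/
theorem exists_average {ρ : Representation ℚ (F ≃ₐ[k] F) W} {W' : Submodule ℚ W}
    {H : Subgroup (F ≃ₐ[k] F)} {w : W} (hfin : ((fun g => ρ g w) '' (H : Set (F ≃ₐ[k] F))).Finite)
    (hW' : ∀ g ∈ H, ρ g w - w ∈ W') : ∃ v, v - w ∈ W' ∧ H ≤ vecStab ρ v := by
  classical
  let O := hfin.toFinset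
  have hO : ∀ v, v ∈ O ↔ ∃ g ∈ H, ρ g w = v := fun v => by simp [O]
  have hcard : (O.card : ℚ) ≠ 0 := by
    have : w ∈ O := (hO w).2 ⟨1, one_mem H, by simp⟩
    exact Nat.cast_ne_zero.2 (Finset.card_ne_zero_of_mem this)
  refine ⟨(O.card : ℚ)⁻¹ • ∑ v ∈ O, v, ?_, fun h hh => ?_⟩
  · have : (O.card : ℚ)⁻¹ • ∑ v ∈ O, v - w = (O.card : ℚ)⁻¹ • ∑ v ∈ O, (v - w) := by
      rw [Finset.sum_sub_distrib, Finset.sum_const, smul_sub, ← Nat.cast_smul_eq_nsmul ℚ,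
        inv_smul_smul₀ hcard]
    rw [this]
    refine W'.smul_mem _ (W'.sum_mem fun v hv => ?_)
    obtain ⟨g, hg, rfl⟩ := (hO v).1 hv
    exact hW' g hg
  · rw [mem_vecStab, map_smul, map_sum]
    congr 1
    refine Finset.sum_bij' (fun v _ => ρ h v) (fun v _ => ρ h⁻¹ v) ?_ ?_ ?_ ?_ ?_
    · intro v hv
      obtain ⟨g, hg, rfl⟩ := (hO v).1 hv
      exact (hO _).2 ⟨h * g, mul_mem hh hg, by simp⟩
    · intro v hv
      obtain ⟨g, hg, rfl⟩ := (hO v).1 hv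
      exact (hO _).2 ⟨h⁻¹ * g, mul_mem (inv_mem hh) hg, by simp⟩
    · simp
    · simp
    · simp

theorem finite_orbit_of_mem_algSpan {ρ : Representation ℚ (F ≃ₐ[k] F) W} {A : Set F} {x : F}
    (hx : x ∈ algSpan k A) {w : W}
    (hw : fixingSubgroup (F ≃ₐ[k] F) (insert x A) ≤ vecStab ρ w) :
    ((fun g => ρ g w) '' (fixingSubgroup (F ≃ₐ[k] F) A : Set (F ≃ₐ[k] F))).Finite := by
  classical
  set H := fixingSubgroup (F ≃ₐ[k] F) A
  have hfin : ((fun g : F ≃ₐ[k] F => g x) '' (H : Set (F ≃ₐ[k] F))).Finite := by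
    refine ((minpoly (IntermediateField.adjoin k A) x).rootSet_finite F).subset ?_
    rintro _ ⟨g, hg, rfl⟩
    let f : F ≃ₐ[IntermediateField.adjoin k A] F :=
      AlgEquiv.ofRingEquiv (f := g.toRingEquiv) fun r => fixes_adjoin hg r.2
    rw [mem_algSpan_iff] at hx
    rw [Polynomial.mem_rootSet]
    refine ⟨minpoly.ne_zero hx.isIntegral, ?_⟩
    have : Polynomial.aeval (f x) (minpoly (IntermediateField.adjoin k A) x) = 0 := by
      rw [Polynomial.aeval_algHom_apply, minpoly.aeval, map_zero]
    exact this
  let φ : F → W := fun y => if h : ∃ g ∈ H, g x = y then ρ h.choose w else 0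
  refine (hfin.image φ).subset ?_
  rintro _ ⟨g, hg, rfl⟩
  refine ⟨g x, ⟨g, hg, rfl⟩, ?_⟩
  have h : ∃ g' ∈ H, g' x = g x := ⟨g, hg, rfl⟩
  have hmem : ρ (h.choose⁻¹ * g) w = w :=
    hw (inv_mul_mem_of_apply_eq h.choose_spec.1 hg h.choose_spec.2)
  simp only [φ, dif_pos h]
  conv_lhs => rw [← hmem]
  simp

/-- A vector whose class modulo `W'` is fixed by the stabilizer of `E` is congruent to a vector
fixed by that stabilizer. -/
theorem IsHomotopyInvariantRep.exists_lift {ρ : Representation ℚ (F ≃ₐ[k] F) W}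
    (hρ : IsHomotopyInvariantRep ρ) {W' : Submodule ℚ W}
    (hst : ∀ g : F ≃ₐ[k] F, ∀ w ∈ W', ρ g w ∈ W') {E S : Set F} (hS : S.Finite) :
    ∀ {w : W}, (∀ g ∈ fixingSubgroup (F ≃ₐ[k] F) E, ρ g w - w ∈ W') →
      fixingSubgroup (F ≃ₐ[k] F) (E ∪ S) ≤ vecStab ρ w →
      ∃ v, v - w ∈ W' ∧ fixingSubgroup (F ≃ₐ[k] F) E ≤ vecStab ρ v := by
  induction S, hS using Set.Finite.induction_on with
  | empty => exact fun {w} _ hw => ⟨w, by simp, by rwa [Set.union_empty] at hw⟩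
  | @insert x S _ _ ih =>
    intro w hE hw
    rw [Set.union_insert] at hw
    by_cases hx : x ∈ algSpan k (E ∪ S)
    · obtain ⟨v, hvw, hv⟩ := exists_average (finite_orbit_of_mem_algSpan hx hw)
        fun g hg => hE g (fixingSubgroup_antitone _ _ Set.subset_union_left hg)
      have hEv : ∀ g ∈ fixingSubgroup (F ≃ₐ[k] F) E, ρ g v - v ∈ W' := fun g hg => by
        have : ρ g v - v = ρ g (v - w) + (ρ g w - w) - (v - w) := by
          rw [map_sub]
          abel
        rw [this]
        exact W'.sub_mem (W'.add_mem (hst g _ hvw) (hE g hg)) hvw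
      obtain ⟨u, huv, hu⟩ := ih hEv hv
      refine ⟨u, ?_, hu⟩
      rw [← sub_add_sub_cancel u v w]
      exact W'.add_mem huv hvw
    · exact ih hE (hρ.fixingSubgroup_le hx hw)

theorem mem_vecStab_quotRep {ρ : Representation ℚ (F ≃ₐ[k] F) W} {W' : Submodule ℚ W}
    {hst : ∀ g : F ≃ₐ[k] F, ∀ w ∈ W', ρ g w ∈ W'} {g : F ≃ₐ[k] F} {w : W} :
    g ∈ vecStab (quotRep ρ W' hst) (Submodule.Quotient.mk w) ↔ ρ g w - w ∈ W' :=
  Submodule.Quotient.eq W'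

theorem vecStab_subRep {ρ : Representation ℚ (F ≃ₐ[k] F) W} {W' : Submodule ℚ W}
    {hst : ∀ g : F ≃ₐ[k] F, ∀ w ∈ W', ρ g w ∈ W'} (w : W') :
    vecStab (subRep ρ W' hst) w = vecStab ρ w :=
  Subgroup.ext fun _ => Subtype.ext_iff

theorem IsHomotopyInvariantRep.subRep {ρ : Representation ℚ (F ≃ₐ[k] F) W}
    (hρ : IsHomotopyInvariantRep ρ) {W' : Submodule ℚ W}
    (hst : ∀ g : F ≃ₐ[k] F, ∀ w ∈ W', ρ g w ∈ W') : IsHomotopyInvariantRep (subRep ρ W' hst) := by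
  intro L L' h
  ext w
  rw [mem_fixedSubmodule_iff, mem_fixedSubmodule_iff, vecStab_subRep, ← mem_fixedSubmodule_iff,
    ← mem_fixedSubmodule_iff, hρ L L' h]

theorem IsPurelyTranscendentalExt.le {L L' : IntermediateField k F}
    (h : IsPurelyTranscendentalExt L L') : L ≤ L' := by
  obtain ⟨s, -, rfl⟩ := h
  exact fun x hx => IntermediateField.algebraMap_mem (IntermediateField.adjoin L s) ⟨x, hx⟩

theorem IsHomotopyInvariantRep.quotRep {ρ : Representation ℚ (F ≃ₐ[k] F) W}
    (hρ : IsHomotopyInvariantRep ρ) (hsm : IsSmoothRep ρ) {W' : Submodule ℚ W}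
    (hst : ∀ g : F ≃ₐ[k] F, ∀ w ∈ W', ρ g w ∈ W') : IsHomotopyInvariantRep (quotRep ρ W' hst) := by
  intro L L' h
  refine le_antisymm (fun w hw => ?_) fun w hw => ?_
  · exact fun g hg => hw g (fixingSubgroup_antitone (F ≃ₐ[k] F) F h.le hg)
  obtain ⟨w, rfl⟩ := Submodule.Quotient.mk_surjective W' w
  obtain ⟨S, hS, hSw⟩ := hsm.exists_finite w
  obtain ⟨v, hvw, hv⟩ := hρ.exists_lift hst (E := L') hS
    (fun g hg => mem_vecStab_quotRep.1 (hw g hg))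
    ((fixingSubgroup_antitone _ _ Set.subset_union_right).trans hSw)
  have hvL : v ∈ fixedSubmodule ρ L.fixingSubgroup := hρ L L' h ▸ hv
  rw [← (Submodule.Quotient.eq W').2 hvw]
  intro g hg
  refine mem_vecStab_quotRep.2 ?_
  rw [hvL g hg, sub_self]
  exact W'.zero_mem

variable [IsAlgClosed F]

/-- Homotopy invariance of a smooth representation can be checked on finitely generated fields
and in one variable. -/
theorem IsSmoothRep.isHomotopyInvariantRep (hn : ∃ x : ℕ → F, IsTranscendenceBasis k x)
    {ρ : Representation ℚ (F ≃ₐ[k] F) W} (hρ : IsSmoothRep ρ)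
    (h : ∀ (A : Set F) (x : F) (w : W), A.Finite → x ∉ algSpan k A →
      fixingSubgroup (F ≃ₐ[k] F) (insert x A) ≤ vecStab ρ w →
      fixingSubgroup (F ≃ₐ[k] F) A ≤ vecStab ρ w) :
    IsHomotopyInvariantRep ρ := by
  rintro L _ ⟨s, hs, rfl⟩
  rw [IntermediateField.restrictScalars_adjoin, fixingSubgroup_adjoin_eq]
  ext w
  rw [mem_fixedSubmodule_iff, mem_fixedSubmodule_iff]
  refine ⟨fun hw => (fixingSubgroup_antitone _ _ Set.subset_union_left).trans hw, fun hw => ?_⟩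
  obtain ⟨S, hS, hSw⟩ := hρ.exists_finite w
  obtain ⟨D, hDE, hD, hDw⟩ := exists_finite_fixingSubgroup_le hn hS hw (Set.empty_subset _)
    Set.finite_empty (by rwa [Set.empty_union])
  have key : ∀ T : Set F, T.Finite → T ⊆ s →
      fixingSubgroup (F ≃ₐ[k] F) (D ∩ L ∪ T) ≤ vecStab ρ w →
      fixingSubgroup (F ≃ₐ[k] F) (D ∩ L) ≤ vecStab ρ w := by
    intro T hT
    induction T, hT using Set.Finite.induction_on with
    | empty => exact fun _ h => by rwa [Set.union_empty] at h
    | @insert x T hxT hT ih =>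
      intro hTs hTw
      rw [Set.insert_subset_iff] at hTs
      rw [Set.union_insert] at hTw
      exact ih hTs.2 (h _ x w ((hD.inter_of_left _).union hT)
        (hs.notMem_algSpan Set.inter_subset_right hTs.2 hTs.1 hxT) hTw)
  refine le_trans (fixingSubgroup_antitone _ _ Set.inter_subset_right)
    (key (D ∩ s) (hD.inter_of_left _) Set.inter_subset_right ?_)
  rwa [← Set.inter_union_distrib_left, Set.inter_eq_left.2 hDE]

/-- An extension of homotopy invariant representations is homotopy invariant. -/
theorem IsHomotopyInvariantRep.of_subRep_of_quotRep
    (hn : ∃ x : ℕ → F, IsTranscendenceBasis k x)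
    {ρ : Representation ℚ (F ≃ₐ[k] F) W} (hsm : IsSmoothRep ρ) {W' : Submodule ℚ W}
    {hst : ∀ g : F ≃ₐ[k] F, ∀ w ∈ W', ρ g w ∈ W'}
    (hsub : IsHomotopyInvariantRep (_root_.subRep ρ W' hst))
    (hquot : IsHomotopyInvariantRep (_root_.quotRep ρ W' hst)) : IsHomotopyInvariantRep ρ := by
  refine hsm.isHomotopyInvariantRep hn fun A x w hA hx hw => ?_
  have hmod : ∀ g ∈ fixingSubgroup (F ≃ₐ[k] F) A, ρ g w - w ∈ W' := fun g hg =>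
    mem_vecStab_quotRep.1 (hquot.fixingSubgroup_le hx (w := Submodule.Quotient.mk w)
      (fun g hg => mem_vecStab_quotRep.2 (by rw [hw hg, sub_self]; exact W'.zero_mem)) hg)
  obtain ⟨y, hy⟩ := exists_notMem_algSpan hn (hA.insert x)
  obtain ⟨f, hfA, hfx, hfy⟩ := exists_swap_of_notMem_algSpan hx hy
  have hcA : fixingSubgroup (F ≃ₐ[k] F) A ≤ vecStab ρ (ρ f w - w) := by
    rw [← vecStab_subRep (hst := hst) ⟨_, hmod f hfA⟩]
    refine hsub.fixingSubgroup_le hx (hsub.fixingSubgroup_le hy ?_)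
    rw [vecStab_subRep]
    intro g hg
    have hgx := fixingSubgroup_antitone (F ≃ₐ[k] F) F (Set.subset_insert y _) hg
    have hgA := fixingSubgroup_antitone (F ≃ₐ[k] F) F (Set.subset_insert x A) hgx
    have hgy : g (f x) = f x := by
      rw [hfx]
      exact (mem_fixingSubgroup_iff _).1 hg y (Set.mem_insert y _)
    have hgf : ρ (f⁻¹ * (g * f)) w = w :=
      hw (inv_mul_mem_of_apply_eq hfA (mul_mem hgA hfA) hgy.symm)
    have hgf' : ρ g (ρ f w) = ρ f w := by
      conv_rhs => rw [← hgf]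
      simp
    rw [mem_vecStab, map_sub, hgf', hw hgx]
  have hff : ρ (f * f) w = w := hw <| by
    simpa using inv_mul_mem_of_apply_eq (x := x) (one_mem _) (mul_mem hfA hfA)
      (by simp [hfx, hfy])
  have hc : ρ f (ρ f w - w) = ρ f w - w := hcA hfA
  rw [map_mul, Module.End.mul_apply] at hff
  rw [map_sub, hff, ← neg_sub, neg_eq_iff_add_eq_zero, ← two_nsmul, ← Nat.cast_smul_eq_nsmul ℚ,
    smul_eq_zero_iff_right (by norm_num), sub_eq_zero] at hc
  exact fixingSubgroup_le_of_pair hn hA hx hy hw (hfx ▸ fixingSubgroup_insert_apply_le hfA hc hw)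

end Fixed

/-- Suppose `n = ∞`.  Homotopy invariant representations form a Serre subcategory
of the category of smooth representations of `G = Aut(F/k)`:
(i) `G`-stable subspaces and quotients of homotopy invariant smooth representations
are homotopy invariant;
(ii) a smooth representation which is an extension of a homotopy invariant
representation by a homotopy invariant one is homotopy invariant. -/
theorem statement8 (k F : Type*) [Field k] [Field F] [Algebra k F]
    [IsAlgClosed k] [IsAlgClosed F] [CharZero k] [CharZero F]
    (hn : ∃ x : ℕ → F, IsTranscendenceBasis k x) :
    (∀ (W : Type u) [AddCommGroup W] [Module ℚ W]
      (ρ : Representation ℚ (F ≃ₐ[k] F) W) (W' : Submodule ℚ W)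
      (hst : ∀ g : F ≃ₐ[k] F, ∀ w ∈ W', ρ g w ∈ W'),
        IsSmoothRep ρ → IsHomotopyInvariantRep ρ →
          IsHomotopyInvariantRep (subRep ρ W' hst) ∧
          IsHomotopyInvariantRep (quotRep ρ W' hst)) ∧
    (∀ (W : Type u) [AddCommGroup W] [Module ℚ W]
      (ρ : Representation ℚ (F ≃ₐ[k] F) W) (W' : Submodule ℚ W)
      (hst : ∀ g : F ≃ₐ[k] F, ∀ w ∈ W', ρ g w ∈ W'),
        IsSmoothRep ρ → IsHomotopyInvariantRep (subRep ρ W' hst) →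
          IsHomotopyInvariantRep (quotRep ρ W' hst) → IsHomotopyInvariantRep ρ) := by
  refine ⟨fun W _ _ ρ W' hst hsm hρ => ⟨hρ.subRep hst, hρ.quotRep hsm hst⟩,
    fun W _ _ ρ W' hst hsm hsub hquot => ?_⟩
  exact IsHomotopyInvariantRep.of_subRep_of_quotRep hn hsm hsub hquot
end

section
/- Suppose n = ∞. Then every smooth representation of G on a finite-dimensional ℚ-vector space is trivial: every element of G acts as the identity map. -/
universe u

section AuxiliaryResults

open scoped TensorProduct Cardinal

/-- A nonzero element of a finitely generated domain over an algebraically closed field is nonzero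
at some rational point. -/
theorem exists_algHom_apply_ne_zero {k R : Type*} [Field k] [IsAlgClosed k] [CommRing R]
    [IsDomain R] [Algebra k R] [Algebra.FiniteType k R] {r : R} (hr : r ≠ 0) :
    ∃ φ : R →ₐ[k] k, φ r ≠ 0 := by
  have : Nontrivial (Localization.Away r) :=
    (IsLocalization.injective (Localization.Away r) (M := Submonoid.powers r)
      (powers_le_nonZeroDivisors_of_noZeroDivisors hr)).nontrivial
  have : Algebra.FiniteType k (Localization.Away r) :=
    .trans (S := R) inferInstance (IsLocalization.finiteType_of_monoid_fg (Submonoid.powers r) _)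
  obtain ⟨m, hm⟩ := Ideal.exists_maximal (Localization.Away r)
  let := Ideal.Quotient.field m
  have := finite_of_finite_type_of_isJacobsonRing k (Localization.Away r ⧸ m)
  let e : k ≃ₐ[k] (Localization.Away r ⧸ m) := AlgEquiv.ofBijective (Algebra.ofId _ _)
    (IsAlgClosed.algebraMap_bijective_of_isIntegral (k := k))
  let ψ : R →ₐ[k] (Localization.Away r ⧸ m) :=
    (Ideal.Quotient.mkₐ k m).comp (IsScalarTower.toAlgHom k R (Localization.Away r))
  refine ⟨(e.symm : _ →ₐ[k] k).comp ψ, ?_⟩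
  have hu : IsUnit (ψ r) :=
    (IsLocalization.Away.algebraMap_isUnit (S := Localization.Away r) r).map (Ideal.Quotient.mkₐ k m)
  simpa using hu.ne_zero

theorem range_map_val_mono {k A B : Type*} [CommRing k] [CommRing A] [CommRing B]
    [Algebra k A] [Algebra k B] {S T : Subalgebra k A} (h : S ≤ T) :
    (Algebra.TensorProduct.map S.val (AlgHom.id k B)).range ≤
      (Algebra.TensorProduct.map T.val (AlgHom.id k B)).range := by
  rintro _ ⟨x, rfl⟩
  refine ⟨Algebra.TensorProduct.map (Subalgebra.inclusion h) (AlgHom.id k B) x, ?_⟩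
  change ((Algebra.TensorProduct.map T.val (AlgHom.id k B)).comp
    (Algebra.TensorProduct.map (Subalgebra.inclusion h) (AlgHom.id k B))) x = _
  rw [← Algebra.TensorProduct.map_comp]
  rfl

theorem exists_fg_subalgebra_mem_range_map {k A B : Type*} [CommRing k] [CommRing A] [CommRing B]
    [Algebra k A] [Algebra k B] (u : A ⊗[k] B) :
    ∃ S : Subalgebra k A, S.FG ∧ u ∈ (Algebra.TensorProduct.map S.val (AlgHom.id k B)).range := by
  induction u with
  | zero => exact ⟨⊥, Subalgebra.fg_bot, zero_mem _⟩
  | tmul a b =>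
    exact ⟨Algebra.adjoin k {a}, ⟨{a}, by simp⟩,
      ⟨⟨a, Algebra.self_mem_adjoin_singleton k a⟩ ⊗ₜ b, by simp⟩⟩
  | add u v hu hv =>
    obtain ⟨S, hS, hu⟩ := hu
    obtain ⟨T, hT, hv⟩ := hv
    exact ⟨S ⊔ T, hS.sup hT, add_mem (range_map_val_mono le_sup_left hu)
      (range_map_val_mono le_sup_right hv)⟩

theorem noZeroDivisors_tensorProduct_of_finiteType {k A B : Type*} [Field k] [IsAlgClosed k]
    [CommRing A] [IsDomain A] [CommRing B] [IsDomain B] [Algebra k A] [Algebra k B]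
    [Algebra.FiniteType k A] : NoZeroDivisors (A ⊗[k] B) := by
  refine ⟨fun {u v} huv => ?_⟩
  by_contra! h
  let b := Module.Free.chooseBasis k B
  let c := Algebra.TensorProduct.basis A b
  obtain ⟨i, hi⟩ : ∃ i, c.repr u i ≠ 0 := by
    by_contra! h0
    exact h.1 (c.repr.map_eq_zero_iff.mp (Finsupp.ext h0))
  obtain ⟨j, hj⟩ : ∃ j, c.repr v j ≠ 0 := by
    by_contra! h0
    exact h.2 (c.repr.map_eq_zero_iff.mp (Finsupp.ext h0))
  obtain ⟨φ, hφ⟩ := exists_algHom_apply_ne_zero (k := k) (mul_ne_zero hi hj)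
  rw [map_mul] at hφ
  let Φ : A ⊗[k] B →ₐ[k] B := Algebra.TensorProduct.lift ((Algebra.ofId k B).comp φ)
    (AlgHom.id k B) (fun _ _ => Commute.all _ _)
  have key : ∀ w i, b.repr (Φ w) i = φ (c.repr w i) := by
    intro w i
    induction w with
    | zero => simp
    | tmul x y =>
      simp [Φ, c, Algebra.ofId_apply, ← Algebra.smul_def, Algebra.TensorProduct.basis_repr_tmul]
    | add x y hx hy => simp [hx, hy]
  have hz : Φ u * Φ v = 0 := by rw [← map_mul, huv, map_zero]
  rcases mul_eq_zero.mp hz with h0 | h0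
  · exact hφ (by rw [← key u, h0]; simp)
  · exact hφ (by rw [← key v, h0]; simp)

/-- The tensor product of two domains over an algebraically closed field is a domain. -/
theorem isDomain_tensorProduct_of_isAlgClosed (k A B : Type*) [Field k] [IsAlgClosed k]
    [CommRing A] [IsDomain A] [CommRing B] [IsDomain B] [Algebra k A] [Algebra k B] :
    IsDomain (A ⊗[k] B) := by
  have : NoZeroDivisors (A ⊗[k] B) := by
    refine ⟨fun {u v} huv => ?_⟩
    obtain ⟨S, hS, hu⟩ := exists_fg_subalgebra_mem_range_map u
    obtain ⟨T, hT, hv⟩ := exists_fg_subalgebra_mem_range_map v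
    obtain ⟨u, rfl⟩ := range_map_val_mono (le_sup_left (b := T)) hu
    obtain ⟨v, rfl⟩ := range_map_val_mono (le_sup_right (a := S)) hv
    have : Algebra.FiniteType k ↥(S ⊔ T) := (S ⊔ T).fg_iff_finiteType.mp (hS.sup hT)
    have : NoZeroDivisors (↥(S ⊔ T) ⊗[k] B) := noZeroDivisors_tensorProduct_of_finiteType
    have hinj : Function.Injective
        (Algebra.TensorProduct.map (S ⊔ T).val (AlgHom.id k B)) :=
      Module.Flat.rTensor_preserves_injective_linearMap (M := B) (S ⊔ T).val.toLinearMap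
        Subtype.val_injective
    simp only [AlgHom.toRingHom_eq_coe, RingHom.coe_coe] at huv ⊢
    rw [← map_mul, map_eq_zero_iff _ hinj] at huv
    simpa only [map_eq_zero_iff _ hinj] using mul_eq_zero.mp huv
  have : Nontrivial (A ⊗[k] B) := inferInstance
  exact NoZeroDivisors.to_isDomain _

theorem nonempty_algEquiv_of_isTranscendenceBasis {R K L ι : Type*} [Field R] [Field K] [Field L]
    [Algebra R K] [Algebra R L] [IsAlgClosed K] [IsAlgClosed L] {v : ι → K} {w : ι → L}
    (hv : IsTranscendenceBasis R v) (hw : IsTranscendenceBasis R w) :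
    Nonempty (K ≃ₐ[R] L) := by
  have := IsAlgClosed.isAlgClosure_of_transcendence_basis v hv
  have := IsAlgClosed.isAlgClosure_of_transcendence_basis w hw
  let e := hv.1.aevalEquiv.symm.trans hw.1.aevalEquiv
  refine ⟨AlgEquiv.ofRingEquiv (f := IsAlgClosure.equivOfEquiv K L e.toRingEquiv) fun r => ?_⟩
  rw [IsScalarTower.algebraMap_apply R (Algebra.adjoin R (Set.range v)) K,
    IsAlgClosure.equivOfEquiv_algebraMap]
  simp [e]

/-- Embeddings of an extension of finite transcendence degree into algebraically closed extensions
of transcendence degree `ℵ₀` are conjugate under an isomorphism. -/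
theorem exists_algEquiv_comp_eq {k : Type*} {E K L : Type u} [Field k] [Field E] [Field K] [Field L]
    [Algebra k E] [Algebra k K] [Algebra k L] [IsAlgClosed K] [IsAlgClosed L] [FinTrdeg k E]
    (hK : Algebra.trdeg k K = ℵ₀) (hL : Algebra.trdeg k L = ℵ₀) (i : E →ₐ[k] K) (j : E →ₐ[k] L) :
    ∃ f : K ≃ₐ[k] L, ∀ x, f (i x) = j x := by
  let := i.toRingHom.toAlgebra
  let := j.toRingHom.toAlgebra
  have : IsScalarTower k E K := .of_algebraMap_eq fun x => (i.commutes x).symm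
  have : IsScalarTower k E L := .of_algebraMap_eq fun x => (j.commutes x).symm
  have aux : ∀ c d : Cardinal.{u}, c < ℵ₀ → c + d = ℵ₀ → d = ℵ₀ := by
    intro c d hc h
    refine le_antisymm (h ▸ self_le_add_left d c) ?_
    by_contra! hd
    exact (Cardinal.add_lt_aleph0 hc hd).ne h
  have h1 := aux _ _ (trdeg_lt_aleph0 k E) ((trdeg_add_eq k E (A := K)).trans hK)
  have h2 := aux _ _ (trdeg_lt_aleph0 k E) ((trdeg_add_eq k E (A := L)).trans hL)
  obtain ⟨s, hs⟩ := exists_isTranscendenceBasis E K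
  obtain ⟨t, ht⟩ := exists_isTranscendenceBasis E L
  obtain ⟨e⟩ : Nonempty (s ≃ t) := Cardinal.eq.mp <| by
    rw [hs.cardinalMk_eq_trdeg, ht.cardinalMk_eq_trdeg, h1, h2]
  obtain ⟨f⟩ := nonempty_algEquiv_of_isTranscendenceBasis hs (ht.comp_equiv e)
  exact ⟨f.restrictScalars k, f.commutes⟩

theorem isAlgebraic_algebraicClosure_fractionRing (D : Type*) [CommRing D] [IsDomain D] :
    Algebra.IsAlgebraic D (AlgebraicClosure (FractionRing D)) :=
  have := IsLocalization.isAlgebraic (FractionRing D) (nonZeroDivisors D)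
  Algebra.IsAlgebraic.trans D (FractionRing D) _

theorem trdeg_algebraicClosure_fractionRing_tensorProduct {k : Type*} {F : Type u} [Field k]
    [Field F] [Algebra k F] [IsDomain (F ⊗[k] F)] (hF : Algebra.trdeg k F = ℵ₀) :
    Algebra.trdeg k (AlgebraicClosure (FractionRing (F ⊗[k] F))) = ℵ₀ := by
  set Ω := AlgebraicClosure (FractionRing (F ⊗[k] F))
  let q : F ⊗[k] F →ₐ[k] Ω := IsScalarTower.toAlgHom k (F ⊗[k] F) Ω
  let l : F →ₐ[k] Ω := q.comp Algebra.TensorProduct.includeLeft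
  let r : F →ₐ[k] Ω := q.comp Algebra.TensorProduct.includeRight
  have : FaithfulSMul (F ⊗[k] F) Ω := .trans (F ⊗[k] F) (FractionRing (F ⊗[k] F)) Ω
  refine le_antisymm ?_ (hF ▸ trdeg_le_of_injective l l.injective)
  obtain ⟨t, ht⟩ := exists_isTranscendenceBasis k F
  have htc : #t = ℵ₀ := ht.cardinalMk_eq_trdeg.trans hF
  let s : Set Ω := l '' t ∪ r '' t
  have hs : #s ≤ ℵ₀ := (Cardinal.mk_union_le _ _).trans <|
    Cardinal.add_le_aleph0.mpr ⟨Cardinal.mk_image_le.trans htc.le, Cardinal.mk_image_le.trans htc.le⟩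
  have himg : ∀ f : F →ₐ[k] Ω, f '' t ⊆ s →
      ∀ a, IsAlgebraic (Algebra.adjoin k s) (f a) := by
    intro f hf a
    have ha := ht.isAlgebraic.isAlgebraic a
    rw [Subtype.range_coe] at ha
    have hle : (Algebra.adjoin k t).map f ≤ Algebra.adjoin k s := by
      rw [AlgHom.map_adjoin]
      exact Algebra.adjoin_mono hf
    let g : Algebra.adjoin k t →ₐ[k] Algebra.adjoin k s :=
      (f.comp (Algebra.adjoin k t).val).codRestrict _ fun x => hle ⟨x, x.2, rfl⟩
    exact ha.ringHom_of_comp_eq g f (fun x y h => Subtype.ext (f.injective (congrArg Subtype.val h))) rfl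
  have hq : ∀ x, IsAlgebraic (Algebra.adjoin k s) (q x) := by
    intro x
    induction x with
    | zero => simpa using isAlgebraic_zero
    | tmul a b =>
      have h := (himg l Set.subset_union_left a).mul (himg r Set.subset_union_right b)
      simpa [l, r, ← map_mul] using h
    | add x y hx hy => simpa using hx.add hy
  have : Algebra.IsAlgebraic (Algebra.adjoin k s) Ω := by
    have := isAlgebraic_algebraicClosure_fractionRing (F ⊗[k] F)
    refine ⟨fun z => ?_⟩
    by_contra hz
    refine Transcendental.subalgebraAlgebraicClosure hz ?_
    let g : F ⊗[k] F →+* Subalgebra.algebraicClosure (Algebra.adjoin k s) Ω :=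
      q.toRingHom.codRestrict _ hq
    exact (Algebra.IsAlgebraic.isAlgebraic (R := F ⊗[k] F) z).ringHom_of_comp_eq g (RingHom.id Ω)
      (fun x y h => FaithfulSMul.algebraMap_injective (F ⊗[k] F) Ω (congrArg Subtype.val h)) rfl
  exact (Algebra.IsAlgebraic.trdeg_le_cardinalMk k s).trans hs

/-- Every automorphism agrees on a given finite set with an automorphism fixing pointwise some
translate of that set. The translate is taken generic, via `Frac (F ⊗[k] F)`. -/
theorem exists_eqOn_conj_fixing {k : Type*} {F : Type u} [Field k] [IsAlgClosed k] [Field F]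
    [IsAlgClosed F] [Algebra k F] (hF : Algebra.trdeg k F = ℵ₀) {S : Set F} (hS : S.Finite)
    (g : F ≃ₐ[k] F) :
    ∃ f h : F ≃ₐ[k] F, (∀ s ∈ S, f s = g s) ∧ ∀ s ∈ S, f (h s) = h s := by
  have := isDomain_tensorProduct_of_isAlgClosed k F F
  let Ω := AlgebraicClosure (FractionRing (F ⊗[k] F))
  let q : F ⊗[k] F →ₐ[k] Ω := IsScalarTower.toAlgHom k (F ⊗[k] F) Ω
  have hΩ : Algebra.trdeg k Ω = ℵ₀ := trdeg_algebraicClosure_fractionRing_tensorProduct hF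
  let E := IntermediateField.adjoin k (S ∪ g '' S)
  have : FinTrdeg k E := by
    have : Algebra.EssFiniteType k E := IntermediateField.essFiniteType_iff.mpr
      (IntermediateField.fg_adjoin_of_finite (hS.union (hS.image g)))
    infer_instance
  have hE : S ∪ g '' S ⊆ E := IntermediateField.subset_adjoin _ _
  obtain ⟨θ, hθ⟩ := exists_algEquiv_comp_eq hΩ hF
    ((q.comp Algebra.TensorProduct.includeLeft).comp E.val) E.val
  obtain ⟨h, hh⟩ := exists_algEquiv_comp_eq hF hF E.val
    ((θ : Ω →ₐ[k] F).comp ((q.comp Algebra.TensorProduct.includeRight).comp E.val))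
  obtain ⟨γ, hγ⟩ : ∃ γ : Ω ≃ₐ[k] Ω, ∀ x, γ (q x) =
      q (Algebra.TensorProduct.congr g AlgEquiv.refl x) := by
    let e : F ⊗[k] F ≃ₐ[k] F ⊗[k] F := Algebra.TensorProduct.congr g AlgEquiv.refl
    have : FaithfulSMul (F ⊗[k] F) Ω := .trans (F ⊗[k] F) (FractionRing (F ⊗[k] F)) Ω
    have : Module.IsTorsionFree (F ⊗[k] F) Ω := Module.isTorsionFree_iff_faithfulSMul.mpr this
    have : IsAlgClosure (F ⊗[k] F) Ω :=
      ⟨inferInstance, isAlgebraic_algebraicClosure_fractionRing (F ⊗[k] F)⟩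
    refine ⟨AlgEquiv.ofRingEquiv (f := IsAlgClosure.equivOfEquiv Ω Ω e.toRingEquiv) fun r => ?_,
      fun x => IsAlgClosure.equivOfEquiv_algebraMap Ω Ω e.toRingEquiv x⟩
    rw [IsScalarTower.algebraMap_apply k (F ⊗[k] F) Ω, IsAlgClosure.equivOfEquiv_algebraMap]
    exact congrArg _ (e.commutes r)
  refine ⟨(θ.symm.trans γ).trans θ, h, fun s hs => ?_, fun s hs => ?_⟩
  · have h1 := hθ ⟨s, hE (.inl hs)⟩
    have h2 := hθ ⟨g s, hE (.inr ⟨s, hs, rfl⟩)⟩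
    simp only [AlgHom.comp_apply, IntermediateField.coe_val,
      Algebra.TensorProduct.includeLeft_apply] at h1 h2
    rw [AlgEquiv.trans_apply, AlgEquiv.trans_apply, (AlgEquiv.symm_apply_eq θ).mpr h1.symm, hγ,
      ← h2]
    simp
  · have h1 := hh ⟨s, hE (.inl hs)⟩
    simp only [AlgHom.comp_apply, IntermediateField.coe_val, AlgEquiv.coe_toAlgHom,
      Algebra.TensorProduct.includeRight_apply] at h1
    rw [h1, AlgEquiv.trans_apply, AlgEquiv.trans_apply, AlgEquiv.symm_apply_apply, hγ]
    simp


theorem IsSmoothRep.exists_finset {k F : Type*} [Field k] [Field F] [Algebra k F] {W : Type u}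
    [AddCommGroup W] [Module ℚ W] {ρ : Representation ℚ (F ≃ₐ[k] F) W} (hsm : IsSmoothRep ρ)
    (w : W) : ∃ S : Finset F, ∀ g : F ≃ₐ[k] F, (∀ s ∈ S, g s = s) → ρ g w = w := by
  obtain ⟨U, hU, hUeq⟩ := hsm w
  have h1 : (fun x : F => (1 : F ≃ₐ[k] F) x) ∈ U := by
    change (1 : F ≃ₐ[k] F) ∈ (fun (g : F ≃ₐ[k] F) (x : F) => g x) ⁻¹' U
    rw [hUeq]
    simp
  let : TopologicalSpace F := ⊥
  obtain ⟨S, V, hV, hSV⟩ := isOpen_pi_iff.mp hU _ h1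
  refine ⟨S, fun g hg => ?_⟩
  have hgU : (fun x => g x) ∈ U := hSV fun s hs => by
    have := (hV s hs).2
    simpa [hg s hs] using this
  change g ∈ {g : F ≃ₐ[k] F | ρ g w = w}
  rw [← hUeq]
  exact hgU

theorem IsSmoothRep.exists_finite_forall_eq_one {k F : Type*} [Field k] [Field F] [Algebra k F]
    {W : Type u} [AddCommGroup W] [Module ℚ W] [FiniteDimensional ℚ W]
    {ρ : Representation ℚ (F ≃ₐ[k] F) W} (hsm : IsSmoothRep ρ) :
    ∃ S : Set F, S.Finite ∧ ∀ g : F ≃ₐ[k] F, (∀ s ∈ S, g s = s) → ρ g = 1 := by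
  let b := Module.finBasis ℚ W
  choose S hS using hsm.exists_finset
  refine ⟨⋃ i, S (b i), Set.finite_iUnion fun i => (S (b i)).finite_toSet, fun g hg => ?_⟩
  exact b.ext fun i => hS (b i) g fun s hs => hg s (Set.mem_iUnion.mpr ⟨i, hs⟩)

end AuxiliaryResults

/-- Suppose `n = ∞`.  Every smooth representation of `G = Aut(F/k)` on a
finite-dimensional `ℚ`-vector space is trivial: every element of `G` acts as
the identity. -/
theorem statement9 (k F : Type*) [Field k] [Field F] [Algebra k F]
    [IsAlgClosed k] [IsAlgClosed F] [CharZero k] [CharZero F]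
    (hn : ∃ x : ℕ → F, IsTranscendenceBasis k x)
    (W : Type u) [AddCommGroup W] [Module ℚ W] [FiniteDimensional ℚ W]
    (ρ : Representation ℚ (F ≃ₐ[k] F) W)
    (hsm : IsSmoothRep ρ) :
    ∀ g : F ≃ₐ[k] F, ρ g = LinearMap.id := by
  obtain ⟨x, hx⟩ := hn
  have hF : Algebra.trdeg k F = Cardinal.aleph0 := by
    have h := hx.lift_cardinalMk_eq_trdeg
    simpa using h.symm
  obtain ⟨S, hSfin, hS⟩ := hsm.exists_finite_forall_eq_one
  intro g
  obtain ⟨f, h, hfg, hfh⟩ := exists_eqOn_conj_fixing hF hSfin g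
  have hconj : ρ (h⁻¹ * f * h) = 1 := hS _ fun s hs =>
    (AlgEquiv.symm_apply_eq h).mpr (hfh s hs)
  have hf : ρ f = 1 := by
    calc ρ f = ρ h * ρ (h⁻¹ * f * h) * ρ h⁻¹ := by rw [← map_mul, ← map_mul]; group
      _ = 1 := by rw [hconj, mul_one, ← map_mul, mul_inv_cancel, map_one]
  have hgf : ρ (f⁻¹ * g) = 1 := hS _ fun s hs =>
    (AlgEquiv.symm_apply_eq f).mpr (hfg s hs).symm
  calc ρ g = ρ f * ρ (f⁻¹ * g) := by rw [← map_mul, mul_inv_cancel_left]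
    _ = LinearMap.id := by rw [hf, hgf, mul_one]; rfl
end

section
/- (i) If A ⊆ F is an additive subgroup with k ⊆ A, A stable under the action of G°, and A ≠ k, then A = F (i.e., the G°-module F/k is irreducible). (ii) If M ⊆ F^× is a multiplicative subgroup with k^× ⊆ M, M stable under the action of G°, and M ≠ k^×, then M = F^× (i.e., the G°-module F^×/k^× is irreducible). -/
/-- `G°`: the subgroup of `G = Aut(F/k)` generated by the union of all
compact subgroups of `G`. -/
def Gcirc (k F : Type*) [Field k] [Field F] [Algebra k F] : Subgroup (F ≃ₐ[k] F) :=
  Subgroup.closure {g | ∃ K : Subgroup (F ≃ₐ[k] F),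
    @IsCompact _ (autTop k F) (K : Set (F ≃ₐ[k] F)) ∧ g ∈ K}

/-- Translating the variable by `a` changes the subleading coefficient of a monic polynomial of
degree `d` by `d * a`. -/
theorem Polynomial.Monic.nextCoeff_comp_X_add_C {R : Type*} [CommRing R] [Nontrivial R]
    {p : Polynomial R} (hp : p.Monic) (a : R) :
    (p.comp (X + C a)).nextCoeff = p.nextCoeff + p.natDegree * a := by
  rcases Nat.eq_zero_or_pos p.natDegree with h0 | hpos
  · have hp1 := (hp.natDegree_eq_zero).1 h0
    simp [hp1]
  obtain ⟨d, hd⟩ := Nat.exists_eq_succ_of_ne_zero hpos.ne'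
  have hdeg : (taylor a p).natDegree = d + 1 := by rw [natDegree_taylor, hd]
  rw [← taylor_apply, nextCoeff_of_natDegree_pos (by omega), nextCoeff_of_natDegree_pos hpos, hdeg,
    hd, Nat.succ_sub_one, taylor_coeff,
    eval_eq_sum_range' (n := 2) (by have := natDegree_hasseDeriv_le p d; omega)]
  have hlead : p.coeff (d + 1) = 1 := by rw [← hp.coeff_natDegree, hd]
  simp [Finset.sum_range_succ, hasseDeriv_coeff, add_comm 1 d, hlead]

section Gcirc

variable {k F : Type*} [Field k] [Field F] [Algebra k F]

/-- If `F` is algebraic over an intermediate field `L`, then `Aut(F/L)` is compact. -/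
theorem isCompact_fixingSubgroup (L : IntermediateField k F) [Algebra.IsAlgebraic L F] :
    @IsCompact _ (autTop k F) (L.fixingSubgroup : Set (F ≃ₐ[k] F)) := by
  let : TopologicalSpace F := ⊥
  have : DiscreteTopology F := ⟨rfl⟩
  let := autTop k F
  have hind : Topology.IsInducing (fun (g : F ≃ₐ[k] F) (x : F) => g x) := ⟨rfl⟩
  rw [hind.isCompact_iff]
  have himage : (fun (g : F ≃ₐ[k] F) (x : F) => g x) '' (L.fixingSubgroup : Set (F ≃ₐ[k] F)) =
      {f : F → F | (∀ x y, f (x + y) = f x + f y) ∧ (∀ x y, f (x * y) = f x * f y) ∧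
        ∀ x ∈ L, f x = x} := by
    ext f
    constructor
    · rintro ⟨g, hg, rfl⟩
      exact ⟨map_add g, map_mul g, (IntermediateField.mem_fixingSubgroup_iff _ _).1 hg⟩
    · rintro ⟨hadd, hmul, hfix⟩
      let φ : F →ₐ[L] F :=
        { toFun := f
          map_one' := hfix 1 L.one_mem
          map_mul' := hmul
          map_zero' := hfix 0 L.zero_mem
          map_add' := hadd
          commutes' := fun x => hfix _ x.2 }
      refine ⟨(AlgEquiv.ofBijective φ (Algebra.IsAlgebraic.algHom_bijective φ)).restrictScalars k,
        ?_, rfl⟩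
      exact (IntermediateField.mem_fixingSubgroup_iff _ _).2 hfix
  rw [himage]
  have hcompact : IsCompact (Set.univ.pi fun x : F => (minpoly L x).rootSet F) :=
    isCompact_univ_pi fun x => (Polynomial.rootSet_finite _ _).isCompact
  refine hcompact.of_isClosed_subset ?_ ?_
  · simp only [Set.ofPred_and, Set.ofPred_forall]
    refine .inter ?_ (.inter ?_ ?_)
    · exact isClosed_iInter fun x => isClosed_iInter fun y =>
        isClosed_eq (continuous_apply _) (by fun_prop)
    · exact isClosed_iInter fun x => isClosed_iInter fun y =>
        isClosed_eq (continuous_apply _) (by fun_prop)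
    · exact isClosed_iInter fun x => isClosed_iInter fun _ =>
        isClosed_eq (continuous_apply _) continuous_const
  · rw [← himage]
    rintro _ ⟨g, hg, rfl⟩ x -
    have hg' := (IntermediateField.mem_fixingSubgroup_iff _ _).1 hg
    let φ : F →ₐ[L] F := { (g : F →+* F) with commutes' := fun x => hg' _ x.2 }
    rw [Polynomial.mem_rootSet]
    refine ⟨minpoly.ne_zero (Algebra.IsIntegral.isIntegral x), ?_⟩
    have := Polynomial.aeval_algHom_apply φ x (minpoly L x)
    rw [minpoly.aeval, map_zero] at this
    exact this

theorem mem_Gcirc_of_isAlgebraic_fixed (g : F ≃ₐ[k] F) (L : IntermediateField k F)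
    [Algebra.IsAlgebraic L F] (hg : ∀ x ∈ L, g x = x) : g ∈ Gcirc k F :=
  Subgroup.subset_closure ⟨L.fixingSubgroup, isCompact_fixingSubgroup L,
    (IntermediateField.mem_fixingSubgroup_iff _ _).2 hg⟩

/-- An automorphism that is an involution on a transcendence basis lies in `G°`. -/
theorem mem_Gcirc_of_involutive_on_basis {ι : Type*} {x : ι → F} (hx : IsTranscendenceBasis k x)
    (g : F ≃ₐ[k] F) (hg : ∀ i, g (g (x i)) = x i) : g ∈ Gcirc k F := by
  let L := IntermediateField.fixedField (Subgroup.zpowers g)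
  have hL (u : F) : u ∈ L ↔ g u = u := by
    rw [IntermediateField.mem_fixedField_iff]
    refine ⟨fun h => h g (Subgroup.mem_zpowers g), fun h f hf => ?_⟩
    have : Subgroup.zpowers g ≤ MulAction.stabilizer (F ≃ₐ[k] F) u := by
      rw [Subgroup.zpowers_le]
      exact h
    exact this hf
  have halg : Algebra.IsAlgebraic L F := by
    refine hx.isAlgebraic_iff.2 fun i => ?_
    let s : L := ⟨x i + g (x i), (hL _).2 (by rw [map_add, hg, add_comm])⟩
    let p : L := ⟨x i * g (x i), (hL _).2 (by rw [map_mul, hg, mul_comm])⟩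
    refine ⟨Polynomial.X ^ 2 - Polynomial.C s * Polynomial.X + Polynomial.C p, ?_, ?_⟩
    · have : (Polynomial.X ^ 2 - Polynomial.C s * Polynomial.X + Polynomial.C p).Monic := by
        monicity!
      exact this.ne_zero
    · have hs : algebraMap L F s = x i + g (x i) := rfl
      have hp : algebraMap L F p = x i * g (x i) := rfl
      simp only [map_add, map_sub, map_mul, map_pow, Polynomial.aeval_X, Polynomial.aeval_C, hs, hp]
      ring
  exact mem_Gcirc_of_isAlgebraic_fixed g L fun u hu => (hL u).1 hu

theorem transcendental_iff_notMem_range [IsAlgClosed k] {a : F} :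
    Transcendental k a ↔ a ∉ Set.range (algebraMap k F) := by
  rw [Transcendental, not_iff_not]
  refine ⟨fun ha => ?_, ?_⟩
  · exact minpoly.mem_range_of_degree_eq_one k a
      (IsAlgClosed.degree_eq_one_of_irreducible k (minpoly.irreducible ha.isIntegral))
  · rintro ⟨c, rfl⟩
    exact isAlgebraic_algebraMap c

theorem isTranscendenceBasis_const (h : Algebra.trdeg k F = 1) {y : F} (hy : Transcendental k y) :
    IsTranscendenceBasis k fun _ : Unit => y :=
  AlgebraicIndependent.isTranscendenceBasis_of_lift_trdeg_le_of_finite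
    (algebraicIndependent_unique_type_iff.2 hy) (by simp [h])

theorem transcendental_inv_of_transcendental [IsAlgClosed k] {y : F} (hy : Transcendental k y) :
    Transcendental k y⁻¹ := by
  rw [transcendental_iff_notMem_range] at hy ⊢
  rintro ⟨d, hd⟩
  exact hy ⟨d⁻¹, by rw [map_inv₀, hd, inv_inv]⟩

variable [IsAlgClosed F]

/-- Two transcendence bases with the same index type are conjugate under `Aut(F/k)`. -/
theorem exists_algEquiv_map_basis {ι : Type*} {x y : ι → F} (hx : IsTranscendenceBasis k x)
    (hy : IsTranscendenceBasis k y) : ∃ g : F ≃ₐ[k] F, ∀ i, g (x i) = y i := by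
  let := IsAlgClosed.isAlgClosure_of_transcendence_basis x hx
  let := IsAlgClosed.isAlgClosure_of_transcendence_basis y hy
  let e := hx.1.aevalEquiv.symm.trans hy.1.aevalEquiv
  let g := IsAlgClosure.equivOfEquiv F F e.toRingEquiv
  have hg (p : MvPolynomial ι k) : g (MvPolynomial.aeval x p) = MvPolynomial.aeval y p := by
    rw [← hx.1.algebraMap_aevalEquiv, ← hy.1.algebraMap_aevalEquiv]
    refine (IsAlgClosure.equivOfEquiv_algebraMap F F e.toRingEquiv _).trans ?_
    simp [e]
  refine ⟨AlgEquiv.ofRingEquiv (f := g) fun c => ?_, fun i => ?_⟩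
  · simpa using hg (MvPolynomial.C c)
  · simpa using hg (MvPolynomial.X i)

/-- An involutive substitution of a transcendence basis lifts to an element of `G°`. -/
theorem exists_mem_Gcirc_map_basis {ι : Type*} {x y : ι → F} (hx : IsTranscendenceBasis k x)
    (hy : IsTranscendenceBasis k y)
    (h : ∀ g : F ≃ₐ[k] F, (∀ i, g (x i) = y i) → ∀ i, g (y i) = x i) :
    ∃ g ∈ Gcirc k F, ∀ i, g (x i) = y i := by
  obtain ⟨g, hg⟩ := exists_algEquiv_map_basis hx hy
  exact ⟨g, mem_Gcirc_of_involutive_on_basis hx g fun i => by rw [hg, h g hg], hg⟩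

theorem exists_mem_Gcirc_swap {a b : F} (hab : AlgebraicIndepOn k id ({a, b} : Set F)) :
    ∃ g ∈ Gcirc k F, g a = b := by
  classical
  obtain ⟨t, hst, ht⟩ := exists_isTranscendenceBasis_superset hab
  let a' : t := ⟨a, hst (by simp)⟩
  let b' : t := ⟨b, hst (by simp)⟩
  have hy : IsTranscendenceBasis k (((↑) : t → F) ∘ Equiv.swap a' b') :=
    (isTranscendenceBasis_equiv _).2 ht
  obtain ⟨g, hg, hgx⟩ := exists_mem_Gcirc_map_basis ht hy fun g hg i => by
    simp only [Function.comp_apply, hg, Equiv.swap_apply_self]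
  refine ⟨g, hg, ?_⟩
  simpa [a', b'] using hgx a'

/-- In transcendence degree at least two, `G°` is transitive on the transcendental elements. -/
theorem exists_mem_Gcirc_apply_eq (h : 2 ≤ Algebra.trdeg k F) {a b : F} (ha : Transcendental k a)
    (hb : Transcendental k b) : ∃ g ∈ Gcirc k F, g a = b := by
  let M := AlgebraicIndependent.matroid k F
  have hM (u : F) (hu : Transcendental k u) : M.Indep {u} :=
    algebraicIndependent_unique_type_iff.2 hu
  have hpair {u v : F} (hu : Transcendental k u) (hv : v ∉ M.closure {u}) : M.Indep {u, v} := by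
    rw [Set.pair_comm]
    exact ((hM u hu).notMem_closure_iff (Set.mem_univ v)).1 hv |>.1
  by_cases hba : b ∈ M.closure {a}
  · obtain ⟨c, hc⟩ : ∃ c, c ∉ M.closure {a} := by
      by_contra! hall
      have hspan : M.Spanning {a} := by
        rw [Matroid.spanning_iff_closure_eq]
        exact Set.eq_univ_of_forall hall
      have := AlgebraicIndependent.matroid_spanning_iff.1 hspan
      have hle := h.trans (Algebra.IsAlgebraic.trdeg_le_cardinalMk k ({a} : Set F))
      simp at hle
    have hcb : c ∉ M.closure {b} := fun hcb =>
      hc (M.closure_subset_closure_of_subset_closure (Set.singleton_subset_iff.2 hba) hcb)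
    obtain ⟨g, hg, hgac⟩ := exists_mem_Gcirc_swap (hpair ha hc)
    obtain ⟨f, hf, hfcb⟩ := exists_mem_Gcirc_swap (a := c) (b := b)
      (Set.pair_comm b c ▸ hpair hb hcb)
    exact ⟨f * g, mul_mem hf hg, by rw [AlgEquiv.mul_apply, hgac, hfcb]⟩
  · exact exists_mem_Gcirc_swap (hpair ha hba)

theorem exists_mem_Gcirc_of_involution (h : Algebra.trdeg k F = 1) {y z : F}
    (hy : Transcendental k y) (hz : Transcendental k z)
    (hyz : ∀ g : F ≃ₐ[k] F, g y = z → g z = y) : ∃ g ∈ Gcirc k F, g y = z := by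
  obtain ⟨g, hg, hgy⟩ := exists_mem_Gcirc_map_basis (isTranscendenceBasis_const h hy)
    (isTranscendenceBasis_const h hz) fun g hg _ => hyz g (hg ())
  exact ⟨g, hg, hgy ()⟩

section Moebius

variable [IsAlgClosed k]

theorem exists_mem_Gcirc_sub (h : Algebra.trdeg k F = 1) {y : F} (hy : Transcendental k y)
    (c : k) : ∃ g ∈ Gcirc k F, g y = algebraMap k F c - y := by
  refine exists_mem_Gcirc_of_involution h hy ?_ fun g hg => by simp [hg]
  rw [transcendental_iff_notMem_range] at hy ⊢
  rintro ⟨d, hd⟩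
  exact hy ⟨c - d, by rw [map_sub, hd]; ring⟩

theorem exists_mem_Gcirc_div (h : Algebra.trdeg k F = 1) {y : F} (hy : Transcendental k y)
    {c : k} (hc : c ≠ 0) : ∃ g ∈ Gcirc k F, g y = algebraMap k F c / y := by
  have hc' : algebraMap k F c ≠ 0 := by simpa using hc
  refine exists_mem_Gcirc_of_involution h hy ?_ fun g hg => by
    rw [map_div₀, hg, AlgEquiv.commutes, div_div_cancel₀ hc']
  rw [transcendental_iff_notMem_range] at hy ⊢
  rintro ⟨d, hd⟩
  exact hy ⟨c / d, by rw [map_div₀, hd, div_div_cancel₀ hc']⟩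

variable {S : Set F}

theorem div_mem_of_Gcirc_stable (h : Algebra.trdeg k F = 1)
    (hS : ∀ g ∈ Gcirc k F, ∀ a ∈ S, g a ∈ S) {y : F} (hy : Transcendental k y) (hyS : y ∈ S)
    {c : k} (hc : c ≠ 0) : algebraMap k F c / y ∈ S := by
  obtain ⟨g, hg, hgy⟩ := exists_mem_Gcirc_div h hy hc
  exact hgy ▸ hS g hg y hyS

theorem exists_mem_Gcirc_add (h : Algebra.trdeg k F = 1) {y : F} (hy : Transcendental k y)
    (c : k) : ∃ g ∈ Gcirc k F, g y = y + algebraMap k F c := by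
  obtain ⟨g, hg, hgy⟩ := exists_mem_Gcirc_sub h hy 0
  obtain ⟨f, hf, hfy⟩ := exists_mem_Gcirc_sub h hy (-c)
  refine ⟨f * g, mul_mem hf hg, ?_⟩
  rw [AlgEquiv.mul_apply, hgy, map_sub, hfy, map_zero, map_zero, map_neg]
  ring

theorem add_mem_of_Gcirc_stable (h : Algebra.trdeg k F = 1)
    (hS : ∀ g ∈ Gcirc k F, ∀ a ∈ S, g a ∈ S) {y : F} (hy : Transcendental k y) (hyS : y ∈ S)
    (c : k) : y + algebraMap k F c ∈ S := by
  obtain ⟨g, hg, hgy⟩ := exists_mem_Gcirc_add h hy c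
  exact hgy ▸ hS g hg y hyS

theorem inv_mem_of_Gcirc_stable (h : Algebra.trdeg k F = 1)
    (hS : ∀ g ∈ Gcirc k F, ∀ a ∈ S, g a ∈ S) {y : F} (hy : Transcendental k y) (hyS : y ∈ S) :
    y⁻¹ ∈ S := by
  simpa using div_mem_of_Gcirc_stable h hS hy hyS (one_ne_zero (α := k))

theorem const_mul_mem_of_Gcirc_stable (h : Algebra.trdeg k F = 1)
    (hS : ∀ g ∈ Gcirc k F, ∀ a ∈ S, g a ∈ S) {y : F} (hy : Transcendental k y) (hyS : y ∈ S)
    {c : k} (hc : c ≠ 0) : algebraMap k F c * y ∈ S := by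
  have := div_mem_of_Gcirc_stable h hS (transcendental_inv_of_transcendental hy)
    (inv_mem_of_Gcirc_stable h hS hy hyS) hc
  rwa [div_inv_eq_mul] at this

/-- In characteristic zero and transcendence degree one, a `G°`-stable intermediate field with a
transcendental element is everything. -/
theorem intermediateField_eq_top_of_Gcirc_stable [CharZero k] (h : Algebra.trdeg k F = 1)
    (E : IntermediateField k F) (hE : ∀ g ∈ Gcirc k F, ∀ a ∈ E, g a ∈ E)
    {a : F} (haE : a ∈ E) (ha : Transcendental k a) : E = ⊤ := by
  have : CharZero E := charZero_of_injective_algebraMap (algebraMap k E).injective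
  have halg : Algebra.IsAlgebraic E F := (isTranscendenceBasis_const h ha).isAlgebraic_iff.2
    fun _ => isAlgebraic_algebraMap (⟨a, haE⟩ : E)
  have hint (x : F) : IsIntegral E x := Algebra.IsIntegral.isIntegral x
  -- an element outside `E` is a conjugate of its translates, so its trace over `E` is nonzero
  have hzero (b : F) (hb : (minpoly E b).nextCoeff = 0) : b ∈ E := by
    by_contra hbE
    have hbt : Transcendental k b := by
      rw [transcendental_iff_notMem_range]
      rintro ⟨c, rfl⟩
      exact hbE (E.algebraMap_mem c)
    obtain ⟨g, hg, hgb⟩ := exists_mem_Gcirc_add h hbt 1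
    let σ : E →+* E := ((g : F →+* F).comp (algebraMap E F)).codRestrict E.toSubring
      fun x => hE g hg _ x.2
    have hσ : (algebraMap E F).comp σ = (g : F →+* F).comp (algebraMap E F) := rfl
    have hroot : Polynomial.aeval (b + algebraMap E F 1) ((minpoly E b).map σ) = 0 := by
      have hgb' : b + algebraMap E F 1 = g b := by rw [hgb, map_one, map_one]
      rw [hgb', Polynomial.aeval_def, Polynomial.eval₂_map, hσ]
      have := Polynomial.hom_eval₂ (minpoly E b) (algebraMap E F) (g : F →+* F) b
      rw [← Polynomial.aeval_def, minpoly.aeval, map_zero] at this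
      exact this.symm
    have heq : (minpoly E b).map σ = (minpoly E b).comp (Polynomial.X - Polynomial.C 1) := by
      rw [← minpoly.add_algebraMap]
      refine Polynomial.eq_of_monic_of_dvd_of_natDegree_le (minpoly.monic (hint _))
        ((minpoly.monic (hint b)).map σ) (minpoly.dvd _ _ hroot) ?_
      rw [minpoly.add_algebraMap, Polynomial.natDegree_comp, Polynomial.natDegree_X_sub_C, mul_one,
        (minpoly.monic (hint b)).natDegree_map]
    have hnext := congrArg Polynomial.nextCoeff heq
    rw [Polynomial.nextCoeff_map σ.injective, hb, map_zero] at hnext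
    have hcomp : (minpoly E b).comp (Polynomial.X - Polynomial.C 1) =
        (minpoly E b).comp (Polynomial.X + Polynomial.C (-1)) := by
      rw [Polynomial.C_neg, sub_eq_add_neg]
    rw [hcomp, (minpoly.monic (hint b)).nextCoeff_comp_X_add_C, hb] at hnext
    have := (minpoly.natDegree_pos (hint b)).ne'
    simp [this] at hnext
  refine eq_top_iff.2 fun b _ => ?_
  have hd : ((minpoly E b).natDegree : E) ≠ 0 := by
    exact_mod_cast (minpoly.natDegree_pos (hint b)).ne'
  let t : E := -(minpoly E b).nextCoeff / (minpoly E b).natDegree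
  have hbt : b - algebraMap E F t ∈ E := by
    refine hzero _ ?_
    rw [minpoly.sub_algebraMap, (minpoly.monic (hint b)).nextCoeff_comp_X_add_C,
      mul_div_cancel₀ _ hd]
    ring
  simpa using E.add_mem hbt t.2

theorem sq_mem_of_Gcirc_stable [CharZero k] (h : Algebra.trdeg k F = 1) (A : AddSubgroup F)
    (hA : ∀ c : k, algebraMap k F c ∈ A) (hS : ∀ g ∈ Gcirc k F, ∀ a ∈ A, g a ∈ A)
    {y : F} (hyA : y ∈ A) : y ^ 2 ∈ A := by
  by_cases hy : y ∈ Set.range (algebraMap k F)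
  · obtain ⟨c, rfl⟩ := hy
    rw [← map_pow]
    exact hA _
  have htrans {z : F} (hz : z ∉ Set.range (algebraMap k F)) : Transcendental k z :=
    transcendental_iff_notMem_range.2 hz
  have hne (c : k) : y + algebraMap k F c ≠ 0 := fun h0 =>
    hy ⟨-c, by rw [map_neg, eq_neg_of_add_eq_zero_left h0]⟩
  have hinv (c : k) : (y + algebraMap k F c)⁻¹ ∈ A := by
    refine inv_mem_of_Gcirc_stable (S := A) h hS (htrans ?_)
      (A.add_mem hyA (hA c))
    rintro ⟨d, hd⟩
    exact hy ⟨d - c, by rw [map_sub, hd, add_sub_cancel_right]⟩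
  have : CharZero F := charZero_of_injective_algebraMap (algebraMap k F).injective
  have h1 : y + 1 ≠ 0 := by simpa using hne 1
  have h2 : y + -1 ≠ 0 := by simpa using hne (-1)
  have hfactor : y ^ 2 - 1 = (y + -1) * (y + 1) := by ring
  have hprod : y ^ 2 - 1 ≠ 0 := by
    rw [hfactor]
    exact mul_ne_zero h2 h1
  have hzA : 2 / (y ^ 2 - 1) ∈ A := by
    have hdiff : 2 / (y ^ 2 - 1) = (y + algebraMap k F (-1))⁻¹ - (y + algebraMap k F 1)⁻¹ := by
      rw [map_neg, map_one, hfactor]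
      field_simp
      ring
    rw [hdiff]
    exact A.sub_mem (hinv _) (hinv _)
  have hz : Transcendental k (2 / (y ^ 2 - 1)) := by
    refine htrans ?_
    rintro ⟨d, hd⟩
    refine transcendental_iff_notMem_range.1 ((htrans hy).pow two_pos) ⟨2 / d + 1, ?_⟩
    rw [map_add, map_div₀, hd, map_ofNat, map_one, div_div_cancel₀ two_ne_zero, sub_add_cancel]
  have hmem := div_mem_of_Gcirc_stable (S := A) h hS hz hzA (two_ne_zero (α := k))
  rw [map_ofNat, div_div_cancel₀ two_ne_zero] at hmem
  simpa using A.add_mem hmem (hA 1)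

theorem addSubgroup_eq_top_of_Gcirc_stable [CharZero k] (h : Algebra.trdeg k F = 1)
    (A : AddSubgroup F) (hA : ∀ c : k, algebraMap k F c ∈ A)
    (hS : ∀ g ∈ Gcirc k F, ∀ a ∈ A, g a ∈ A) {a : F} (haA : a ∈ A) (ha : Transcendental k a) :
    A = ⊤ := by
  have : CharZero F := charZero_of_injective_algebraMap (algebraMap k F).injective
  have hhalf {y : F} (hy : y ∈ A) : algebraMap k F 2⁻¹ * y ∈ A := by
    by_cases hyt : y ∈ Set.range (algebraMap k F)
    · obtain ⟨c, rfl⟩ := hyt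
      rw [← map_mul]
      exact hA _
    · exact const_mul_mem_of_Gcirc_stable (S := A) h hS (transcendental_iff_notMem_range.2 hyt) hy
        (inv_ne_zero two_ne_zero)
  let E : IntermediateField k F :=
    { A with
      one_mem' := by simpa using hA 1
      algebraMap_mem' := hA
      mul_mem' := fun {x y} hx hy => by
        have hmul : x * y = algebraMap k F 2⁻¹ * ((x + y) ^ 2 - x ^ 2 - y ^ 2) := by
          rw [map_inv₀, map_ofNat]
          field_simp
          ring
        have hsq {z : F} (hz : z ∈ A) := sq_mem_of_Gcirc_stable h A hA hS hz
        change x * y ∈ A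
        rw [hmul]
        exact hhalf (A.sub_mem (A.sub_mem (hsq (A.add_mem hx hy)) (hsq hx)) (hsq hy))
      inv_mem' := fun y hy => by
        by_cases hyt : y ∈ Set.range (algebraMap k F)
        · obtain ⟨c, rfl⟩ := hyt
          rw [← map_inv₀]
          exact hA _
        · exact inv_mem_of_Gcirc_stable (S := A) h hS (transcendental_iff_notMem_range.2 hyt) hy }
  have hE : E = ⊤ := intermediateField_eq_top_of_Gcirc_stable h E hS haA ha
  exact eq_top_iff.2 fun x _ => show x ∈ E from hE ▸ IntermediateField.mem_top

theorem mem_of_Gcirc_stable_of_mul_mem [CharZero k] (h : Algebra.trdeg k F = 1) (M : Set F)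
    (hmul : ∀ x ∈ M, ∀ y ∈ M, x * y ∈ M) (hinv : ∀ x ∈ M, x⁻¹ ∈ M)
    (hM : ∀ c : k, c ≠ 0 → algebraMap k F c ∈ M) (hS : ∀ g ∈ Gcirc k F, ∀ a ∈ M, g a ∈ M)
    {a : F} (haM : a ∈ M) (ha : Transcendental k a) {x : F} (hx : x ≠ 0) : x ∈ M := by
  have hconst (c : k) : algebraMap k F c = 0 ∨ algebraMap k F c ∈ M := by
    by_cases hc : c = 0
    · exact .inl (by rw [hc, map_zero])
    · exact .inr (hM c hc)
  have hadd_one {y : F} (hy : y ∈ M) : y + 1 = 0 ∨ y + 1 ∈ M := by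
    by_cases hyt : y ∈ Set.range (algebraMap k F)
    · obtain ⟨c, rfl⟩ := hyt
      simpa using hconst (c + 1)
    · have := add_mem_of_Gcirc_stable h hS (transcendental_iff_notMem_range.2 hyt) hy 1
      exact .inr (by simpa using this)
  let E : IntermediateField k F :=
    { carrier := {y | y = 0 ∨ y ∈ M}
      one_mem' := by simpa using hconst 1
      zero_mem' := .inl rfl
      algebraMap_mem' := hconst
      mul_mem' := by
        rintro x y (rfl | hx) (rfl | hy)
        · exact .inl (zero_mul _)
        · exact .inl (zero_mul _)
        · exact .inl (mul_zero _)
        · exact .inr (hmul _ hx _ hy)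
      add_mem' := by
        rintro x y (rfl | hx) hy
        · simpa using hy
        rcases eq_or_ne y 0 with rfl | hy0
        · exact .inr (by simpa using hx)
        have hy := hy.resolve_left hy0
        have hfactor : x + y = y * (x * y⁻¹ + 1) := by field_simp
        change x + y = 0 ∨ x + y ∈ M
        rw [hfactor]
        rcases hadd_one (hmul _ hx _ (hinv _ hy)) with h0 | h1
        · exact .inl (by rw [h0, mul_zero])
        · exact .inr (hmul _ hy _ h1)
      inv_mem' := by
        rintro x (rfl | hx)
        · exact .inl inv_zero
        · exact .inr (hinv _ hx) }
  have hES : ∀ g ∈ Gcirc k F, ∀ y ∈ E, g y ∈ E := by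
    rintro g hg y (rfl | hy)
    · exact .inl (map_zero g)
    · exact .inr (hS g hg y hy)
  have hE : E = ⊤ := intermediateField_eq_top_of_Gcirc_stable h E hES (.inr haM) ha
  have hxE : x ∈ E := hE ▸ IntermediateField.mem_top
  exact hxE.resolve_left hx

end Moebius

end Gcirc

/-- Assume `char k = 0` and `1 ≤ n ≤ ∞`, or `char k` arbitrary and `2 ≤ n ≤ ∞`.
(i) The `G°`-module `F/k` is irreducible: any `G°`-stable additive subgroup of
`F` containing `k` and different from `k` is all of `F`.
(ii) The `G°`-module `F^×/k^×` is irreducible: any `G°`-stable multiplicative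
subgroup of `F^×` containing `k^×` and different from `k^×` is all of `F^×`. -/
theorem statement14 (k F : Type*) [Field k] [Field F] [Algebra k F]
    [IsAlgClosed k] [IsAlgClosed F]
    (hn : (∃ x : ℕ → F, IsTranscendenceBasis k x) ∨
      ∃ n : ℕ, 1 ≤ n ∧ ∃ x : Fin n → F, IsTranscendenceBasis k x)
    (hchar : CharZero k ∨ ((∃ x : ℕ → F, IsTranscendenceBasis k x) ∨
      ∃ n : ℕ, 2 ≤ n ∧ ∃ x : Fin n → F, IsTranscendenceBasis k x)) :
    (∀ A : AddSubgroup F,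
      (∀ c : k, algebraMap k F c ∈ A) →
      (∀ g ∈ Gcirc k F, ∀ a ∈ A, g a ∈ A) →
      (∃ a ∈ A, a ∉ Set.range (algebraMap k F)) →
      A = ⊤) ∧
    (∀ M : Set F,
      (0 : F) ∉ M →
      (∀ x ∈ M, ∀ y ∈ M, x * y ∈ M) →
      (∀ x ∈ M, x⁻¹ ∈ M) →
      (∀ c : k, c ≠ 0 → algebraMap k F c ∈ M) →
      (∀ g ∈ Gcirc k F, ∀ a ∈ M, g a ∈ M) →
      (∃ a ∈ M, a ∉ Set.range (algebraMap k F)) →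
      ∀ x : F, x ≠ 0 → x ∈ M) := by
  have hrank : 2 ≤ Algebra.trdeg k F ∨ (CharZero k ∧ Algebra.trdeg k F = 1) := by
    have hinf : (∃ x : ℕ → F, IsTranscendenceBasis k x) → 2 ≤ Algebra.trdeg k F := by
      rintro ⟨x, hx⟩
      have := hx.lift_cardinalMk_eq_trdeg
      simp only [Cardinal.mk_nat, Cardinal.lift_aleph0, Cardinal.lift_uzero] at this
      exact this ▸ (Cardinal.ofNat_lt_aleph0 (n := 2)).le
    have hfin {n : ℕ} {x : Fin n → F} (hx : IsTranscendenceBasis k x) :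
        Algebra.trdeg k F = n := by
      simpa using hx.lift_cardinalMk_eq_trdeg.symm
    have htwo {n : ℕ} {x : Fin n → F} (hx : IsTranscendenceBasis k x) (h2 : 2 ≤ n) :
        2 ≤ Algebra.trdeg k F := by
      rw [hfin hx]
      exact_mod_cast h2
    rcases hchar with h0 | hinf' | ⟨n, h2, x, hx⟩
    · rcases hn with hinf' | ⟨n, h1, x, hx⟩
      · exact .inl (hinf hinf')
      · rcases h1.eq_or_lt with rfl | h2
        · exact .inr ⟨h0, by simpa using hfin hx⟩
        · exact .inl (htwo hx h2)
    · exact .inl (hinf hinf')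
    · exact .inl (htwo hx h2)
  refine ⟨fun A hA hS ⟨a, haA, ha⟩ => ?_, fun M _ hmul hinv hM hS ⟨a, haM, ha⟩ x hx => ?_⟩ <;>
    rw [← transcendental_iff_notMem_range] at ha
  · rcases hrank with h2 | ⟨h0, h1⟩
    · refine eq_top_iff.2 fun b _ => ?_
      by_cases hb : b ∈ Set.range (algebraMap k F)
      · obtain ⟨c, rfl⟩ := hb
        exact hA c
      · obtain ⟨g, hg, rfl⟩ := exists_mem_Gcirc_apply_eq h2 ha
          (transcendental_iff_notMem_range.2 hb)
        exact hS g hg a haA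
    · exact addSubgroup_eq_top_of_Gcirc_stable h1 A hA hS haA ha
  · rcases hrank with h2 | ⟨h0, h1⟩
    · by_cases hb : x ∈ Set.range (algebraMap k F)
      · obtain ⟨c, rfl⟩ := hb
        exact hM c (by simpa using hx)
      · obtain ⟨g, hg, rfl⟩ := exists_mem_Gcirc_apply_eq h2 ha
          (transcendental_iff_notMem_range.2 hb)
        exact hS g hg a haM
    · exact mem_of_Gcirc_stable_of_mul_mem h1 M hmul hinv hM hS haM ha hx
end

section
/- For every x ∈ F ∖ k, the subfield of F generated by the G°-orbit {σ(x) : σ ∈ G°} of x equals the separable closure of k(x) in F, i.e., the intermediate field consisting of all elements of F that are separable algebraic over k(x). -/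
section

open IntermediateField Polynomial

section SeparableClosureOfSimple

variable {k F : Type*} [Field k] [Field F] [Algebra k F]

/-- The separable closure of `k(x)` in `F`, viewed as an extension of `k`. -/
def sepCl (k : Type*) {F : Type*} [Field k] [Field F] [Algebra k F] (x : F) :
    IntermediateField k F :=
  (separableClosure k⟮x⟯ F).restrictScalars k

theorem mem_sepCl {x y : F} : y ∈ sepCl k x ↔ IsSeparable k⟮x⟯ y :=
  mem_separableClosure_iff

theorem adjoin_le_sepCl (x : F) : k⟮x⟯ ≤ sepCl k x := fun y hy =>
  (separableClosure k⟮x⟯ F).algebraMap_mem ⟨y, hy⟩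

theorem self_mem_sepCl (x : F) : x ∈ sepCl k x :=
  adjoin_le_sepCl x (mem_adjoin_simple_self k x)

/-- A field endomorphism carrying the subfield `K` into `L` carries elements separable over `K`
to elements separable over `L`. -/
theorem IsSeparable.map_of_mapsTo {K L : IntermediateField k F} (θ : F →+* F)
    (h : ∀ a ∈ K, θ a ∈ L) {y : F} (hy : IsSeparable K y) : IsSeparable L (θ y) := by
  let φ : K →+* L := (θ.comp (algebraMap K F)).codRestrict L.toSubfield (fun a => h a a.2)
  have hφ : (algebraMap L F).comp φ = θ.comp (algebraMap K F) := rfl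
  have hsep : ((minpoly K y).map φ).Separable := Polynomial.Separable.map hy
  refine hsep.of_dvd (minpoly.dvd L _ ?_)
  rw [aeval_def, eval₂_map, hφ, ← hom_eval₂, ← aeval_def, minpoly.aeval, map_zero]

theorem map_mem_adjoin_simple (θ : F →+* F) (hθ : ∀ a : k, ∃ b : k, θ (algebraMap k F a) =
    algebraMap k F b) (x : F) : ∀ a ∈ k⟮x⟯, θ a ∈ k⟮θ x⟯ := by
  intro a ha
  induction ha using adjoin_induction with
  | mem y hy =>
    rw [Set.mem_singleton_iff.1 hy]
    exact mem_adjoin_simple_self k _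
  | algebraMap a =>
    obtain ⟨b, hb⟩ := hθ a
    rw [hb]
    exact _root_.algebraMap_mem _ b
  | add a b _ _ ha hb => rw [map_add]; exact add_mem ha hb
  | inv a _ ha => rw [map_inv₀]; exact inv_mem ha
  | mul a b _ _ ha hb => rw [map_mul]; exact mul_mem ha hb

theorem map_mem_sepCl (θ : F →+* F) (hθ : ∀ a : k, ∃ b : k, θ (algebraMap k F a) =
    algebraMap k F b) {x y : F} (h : y ∈ sepCl k x) : θ y ∈ sepCl k (θ x) :=
  mem_sepCl.2 ((mem_sepCl.1 h).map_of_mapsTo θ (map_mem_adjoin_simple θ hθ x))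

theorem algEquiv_mem_sepCl (σ : F ≃ₐ[k] F) {x y : F} (h : y ∈ sepCl k x) :
    σ y ∈ sepCl k (σ x) :=
  map_mem_sepCl (σ : F →+* F) (fun a => ⟨a, σ.commutes a⟩) h

theorem pow_mem_sepCl (p : ℕ) [Fact p.Prime] [CharP F p] (n : ℕ) {x y : F}
    (h : y ∈ sepCl k x) : y ^ p ^ n ∈ sepCl k (x ^ p ^ n) :=
  map_mem_sepCl (iterateFrobenius F p n)
    (fun a => ⟨a ^ p ^ n, by rw [iterateFrobenius_def, map_pow]⟩) h

theorem sepCl_le_of_mem {x y : F} (h : y ∈ sepCl k x) : sepCl k y ≤ sepCl k x := by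
  intro z hz
  have hle : k⟮y⟯ ≤ sepCl k x := adjoin_simple_le_iff.2 h
  have hz' : IsSeparable (sepCl k x) z :=
    (mem_sepCl.1 hz).map_of_mapsTo (RingHom.id F) (fun a ha => hle ha)
  have hbot : z ∈ separableClosure (separableClosure k⟮x⟯ F) F := mem_separableClosure_iff.2 hz'
  rw [separableClosure.separableClosure_eq_bot] at hbot
  obtain ⟨w, rfl⟩ := IntermediateField.mem_bot.1 hbot
  exact w.2

end SeparableClosureOfSimple

section TranscendenceDegreeOne

variable {k F : Type*} [Field k] [Field F] [Algebra k F] [IsAlgClosed k]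

theorem transcendental_of_notMem_range {x : F} (hx : x ∉ Set.range (algebraMap k F)) :
    Transcendental k x := by
  intro h
  exact hx (minpoly.mem_range_of_degree_eq_one k x
    (IsAlgClosed.degree_eq_one_of_irreducible k (minpoly.irreducible h.isIntegral)))

theorem isTranscendenceBasis_of_notMem_range (hb : ∃ x : Fin 1 → F, IsTranscendenceBasis k x)
    {x : F} (hx : x ∉ Set.range (algebraMap k F)) :
    IsTranscendenceBasis k (fun _ : Fin 1 => x) := by
  obtain ⟨b, hb⟩ := hb
  refine AlgebraicIndependent.isTranscendenceBasis_of_lift_trdeg_le_of_finite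
    (algebraicIndependent_unique_type_iff.2 (transcendental_of_notMem_range hx)) ?_
  exact hb.lift_cardinalMk_eq_trdeg.ge

theorem isAlgebraic_adjoin_of_notMem_range (hb : ∃ x : Fin 1 → F, IsTranscendenceBasis k x)
    {x : F} (hx : x ∉ Set.range (algebraMap k F)) : Algebra.IsAlgebraic k⟮x⟯ F := by
  have h := (isTranscendenceBasis_of_notMem_range hb hx).isAlgebraic_field
  rwa [Set.range_const] at h

theorem normal_adjoin_of_notMem_range [IsAlgClosed F]
    (hb : ∃ x : Fin 1 → F, IsTranscendenceBasis k x)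
    {x : F} (hx : x ∉ Set.range (algebraMap k F)) : Normal k⟮x⟯ F := by
  have := isAlgebraic_adjoin_of_notMem_range hb hx
  have : IsAlgClosure k⟮x⟯ F := ⟨inferInstance, inferInstance⟩
  exact IsAlgClosure.normal _ _

theorem exists_algEquiv_apply_eq [IsAlgClosed F]
    (hb : ∃ x : Fin 1 → F, IsTranscendenceBasis k x) {u w : F}
    (hu : u ∉ Set.range (algebraMap k F)) (hw : w ∉ Set.range (algebraMap k F)) :
    ∃ σ : F ≃ₐ[k] F, σ u = w := by
  have hu' := isTranscendenceBasis_of_notMem_range hb hu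
  have hw' := isTranscendenceBasis_of_notMem_range hb hw
  have := IsAlgClosed.isAlgClosure_of_transcendence_basis _ hu'
  have := IsAlgClosed.isAlgClosure_of_transcendence_basis _ hw'
  let e := hu'.1.aevalEquiv.symm.trans hw'.1.aevalEquiv
  let σ : F ≃+* F := IsAlgClosure.equivOfEquiv F F e.toRingEquiv
  have hσ : ∀ s, σ (algebraMap _ F s) = algebraMap _ F (e s) :=
    IsAlgClosure.equivOfEquiv_algebraMap F F e.toRingEquiv
  refine ⟨AlgEquiv.ofRingEquiv (f := σ) fun a => ?_, ?_⟩
  · have := hσ (algebraMap k _ a)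
    rw [AlgEquiv.commutes] at this
    exact this
  · have := hσ (hu'.1.aevalEquiv (MvPolynomial.X 0))
    simp only [e, AlgEquiv.trans_apply, AlgEquiv.symm_apply_apply,
      AlgebraicIndependent.algebraMap_aevalEquiv, MvPolynomial.aeval_X] at this
    exact this

theorem pow_notMem_range {x : F} (hx : x ∉ Set.range (algebraMap k F)) {n : ℕ} (hn : 0 < n) :
    x ^ n ∉ Set.range (algebraMap k F) := by
  rintro ⟨a, ha⟩
  refine transcendental_of_notMem_range hx ⟨X ^ n - C a, X_pow_sub_C_ne_zero hn a, ?_⟩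
  simp [ha]

end TranscendenceDegreeOne

section Topology

variable {k F : Type*} [Field k] [Field F] [Algebra k F]

theorem image_apply_finite_of_isCompact {K : Set (F ≃ₐ[k] F)} (hK : @IsCompact _ (autTop k F) K)
    (x : F) : ((fun g : F ≃ₐ[k] F => g x) '' K).Finite := by
  let : TopologicalSpace F := ⊥
  have : DiscreteTopology F := ⟨rfl⟩
  let : TopologicalSpace (F ≃ₐ[k] F) := autTop k F
  have hcont : Continuous fun g : F ≃ₐ[k] F => g x :=
    (continuous_apply x).comp continuous_induced_dom
  exact (hK.image hcont).finite_of_discrete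

theorem exists_pow_apply_eq_of_isCompact {K : Subgroup (F ≃ₐ[k] F)}
    (hK : @IsCompact _ (autTop k F) (K : Set (F ≃ₐ[k] F))) {σ : F ≃ₐ[k] F} (hσ : σ ∈ K) (x : F) :
    ∃ n, 0 < n ∧ (σ ^ n) x = x := by
  have hfin := image_apply_finite_of_isCompact hK x
  obtain ⟨i, j, hij, h⟩ := Set.Finite.exists_lt_map_eq_of_forall_mem
    (f := fun n : ℕ => (σ ^ n) x) (fun n => Set.mem_image_of_mem _ (pow_mem hσ n)) hfin
  refine ⟨j - i, by omega, (σ ^ i).injective ?_⟩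
  rw [← AlgEquiv.mul_apply, ← pow_add, Nat.add_sub_cancel' hij.le]
  exact h.symm

/-- If `F` is algebraic over `k(t)`, the stabilizer of `t` in `Aut(F/k)` is compact. -/
theorem isCompact_stabilizer (t : F) [Algebra.IsAlgebraic k⟮t⟯ F] :
    @IsCompact _ (autTop k F) (MulAction.stabilizer (F ≃ₐ[k] F) t : Set (F ≃ₐ[k] F)) := by
  let : TopologicalSpace F := ⊥
  have : DiscreteTopology F := ⟨rfl⟩
  let : TopologicalSpace (F ≃ₐ[k] F) := autTop k F
  have hind : Topology.IsInducing (fun (g : F ≃ₐ[k] F) (x : F) => g x) := ⟨rfl⟩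
  rw [hind.isCompact_iff]
  let B : Set (F → F) := Set.univ.pi fun y => {z | aeval z (minpoly k⟮t⟯ y) = 0}
  have hB : IsCompact B := by
    refine isCompact_univ_pi fun y => Set.Finite.isCompact ?_
    have hne : minpoly k⟮t⟯ y ≠ 0 := minpoly.ne_zero (Algebra.IsIntegral.isIntegral y)
    refine ((minpoly k⟮t⟯ y).rootSet_finite F).subset fun z hz => ?_
    exact mem_rootSet.2 ⟨hne, hz⟩
  let A : Set (F → F) := {f | ∀ a b, f (a + b) = f a + f b} ∩ {f | ∀ a b, f (a * b) = f a * f b} ∩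
    {f | ∀ a : k⟮t⟯, f a = a}
  have hA : IsClosed A := by
    refine (IsClosed.inter ?_ ?_).inter ?_
    · simp only [Set.ofPred_forall]
      exact isClosed_iInter fun a => isClosed_iInter fun b => isClosed_eq (by fun_prop) (by fun_prop)
    · simp only [Set.ofPred_forall]
      exact isClosed_iInter fun a => isClosed_iInter fun b => isClosed_eq (by fun_prop) (by fun_prop)
    · simp only [Set.ofPred_forall]
      exact isClosed_iInter fun a => isClosed_eq (by fun_prop) (by fun_prop)
  have hfix : ∀ g : F ≃ₐ[k] F, g t = t → ∀ a ∈ k⟮t⟯, g a = a := by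
    intro g hg a ha
    obtain ⟨r, s, rfl⟩ := (mem_adjoin_simple_iff k a).1 ha
    rw [map_div₀, ← aeval_algHom_apply, ← aeval_algHom_apply, hg]
  convert hB.inter_right hA using 1
  ext f
  constructor
  · rintro ⟨g, hg, rfl⟩
    have hg' := hfix g hg
    refine ⟨fun y _ => ?_, ⟨map_add g, map_mul g⟩, fun a => hg' a a.2⟩
    let g' : F →ₐ[k⟮t⟯] F := { (g : F →+* F) with commutes' := fun a => hg' a a.2 }
    change aeval (g' y) (minpoly k⟮t⟯ y) = 0
    rw [aeval_algHom_apply, minpoly.aeval, map_zero]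
  · rintro ⟨-, ⟨hadd, hmul⟩, hcomm⟩
    let g' : F →ₐ[k⟮t⟯] F :=
      { toFun := f
        map_one' := by simpa using hcomm 1
        map_mul' := hmul
        map_zero' := by simpa using hcomm 0
        map_add' := hadd
        commutes' := hcomm }
    let g : F ≃ₐ[k⟮t⟯] F := AlgEquiv.ofBijective g' (Algebra.IsAlgebraic.algHom_bijective g')
    exact ⟨g.restrictScalars k, hcomm ⟨t, mem_adjoin_simple_self k t⟩, rfl⟩

theorem mem_Gcirc_of_apply_eq {t : F} [Algebra.IsAlgebraic k⟮t⟯ F] {σ : F ≃ₐ[k] F}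
    (h : σ t = t) : σ ∈ Gcirc k F :=
  Subgroup.subset_closure ⟨_, isCompact_stabilizer t, h⟩

end Topology

section PositiveCharacteristic

variable {k F : Type*} [Field k] [Field F] [Algebra k F] [IsAlgClosed k]
  (p : ℕ) [Fact p.Prime] [CharP F p]

/-- A transcendental element is not separable over the field generated by its `p`-th powers. -/
theorem notMem_sepCl_pow {x : F} (hx : x ∉ Set.range (algebraMap k F)) {n : ℕ} (hn : 0 < n) :
    x ∉ sepCl k (x ^ p ^ n) := by
  intro h
  have hbot : x ^ p ^ n ∈ (⊥ : IntermediateField k⟮x ^ p ^ n⟯ F) :=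
    IntermediateField.mem_bot.2 ⟨⟨_, mem_adjoin_simple_self k (x ^ p ^ n)⟩, rfl⟩
  have hx' : x ∈ k⟮x ^ p ^ n⟯⟮x⟯ := mem_adjoin_simple_self _ x
  rw [adjoin_simple_eq_adjoin_pow_expChar_pow_of_isSeparable _ _ (mem_sepCl.1 h) p n,
    adjoin_simple_eq_bot_iff.2 hbot] at hx'
  obtain ⟨⟨y, hy⟩, hyx : y = x⟩ := IntermediateField.mem_bot.1 hx'
  rw [hyx] at hy
  obtain ⟨r, s, hrs⟩ := (mem_adjoin_simple_iff k x).1 hy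
  have htr := transcendental_of_notMem_range hx
  have hs : aeval (x ^ p ^ n) s ≠ 0 := by
    intro h0
    rw [h0, div_zero] at hrs
    exact hx ⟨0, by rw [map_zero, ← hrs]⟩
  have heq : X * expand k (p ^ n) s = expand k (p ^ n) r := by
    refine transcendental_iff_injective.1 htr ?_
    rw [map_mul, aeval_X, expand_aeval, expand_aeval]
    rwa [eq_div_iff hs] at hrs
  have hs0 : expand k (p ^ n) s ≠ 0 := by
    intro h0
    refine hs ?_
    rw [← expand_aeval, h0, map_zero]
  have hdeg := congrArg natDegree heq
  rw [natDegree_X_mul hs0, natDegree_expand, natDegree_expand] at hdeg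
  have hq : p ^ n ∣ 1 := (Nat.dvd_add_right (Dvd.intro_left _ rfl)).1
    (hdeg ▸ Dvd.intro_left _ rfl)
  exact absurd (Nat.dvd_one.1 hq) (Nat.one_lt_pow hn.ne' (Fact.out : p.Prime).one_lt).ne'

theorem sepCl_le_adjoin_frobenius {x : F} :
    ∀ s ∈ sepCl k x, s ∈ IntermediateField.adjoin
      ((sepCl k x).toSubfield.map (frobenius F p)) {x} := by
  intro s hs
  set L := (sepCl k x).toSubfield.map (frobenius F p)
  have hkL : ∀ a : k, algebraMap k F a ∈ L := by
    intro a
    obtain ⟨b, rfl⟩ := IsAlgClosed.exists_pow_nat_eq a (Fact.out : p.Prime).pos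
    exact ⟨algebraMap k F b, _root_.algebraMap_mem (sepCl k x) b,
      by rw [frobenius_def, map_pow]⟩
  have hs' : s ∈ k⟮x⟯⟮s⟯ := mem_adjoin_simple_self _ s
  rw [adjoin_simple_eq_adjoin_pow_expChar_of_isSeparable _ _ (mem_sepCl.1 hs) p] at hs'
  have hx : ∀ a ∈ k⟮x⟯, a ∈ L⟮x⟯ := by
    intro a ha
    induction ha using adjoin_induction with
    | mem y hy => rw [Set.mem_singleton_iff.1 hy]; exact mem_adjoin_simple_self L _
    | algebraMap a => exact _root_.algebraMap_mem L⟮x⟯ (⟨_, hkL a⟩ : L)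
    | add a b _ _ ha hb => exact add_mem ha hb
    | inv a _ ha => exact inv_mem ha
    | mul a b _ _ ha hb => exact mul_mem ha hb
  have hsp : s ^ p ∈ L := ⟨s, hs, rfl⟩
  clear hs
  generalize s ^ p = y at hs' hsp
  induction hs' using adjoin_induction with
  | mem y hy =>
    rw [Set.mem_singleton_iff.1 hy]
    exact _root_.algebraMap_mem L⟮x⟯ (⟨_, hsp⟩ : L)
  | algebraMap a => exact hx a a.2
  | add a b _ _ ha hb => exact add_mem ha hb
  | inv a _ ha => exact inv_mem ha
  | mul a b _ _ ha hb => exact mul_mem ha hb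

/-- In characteristic `p`, if `x ^ p` and `z ^ p` lie in a subfield `L`, `z` lies in `L(x)` but
not in `L`, then `x` lies in `L(z)`. -/
theorem mem_adjoin_of_pow_mem_of_notMem {L : Subfield F} {x z : F} (hx : x ^ p ∈ L)
    (hz : z ^ p ∈ L) (hzL : z ∉ L) (hzx : z ∈ L⟮x⟯) : x ∈ L⟮z⟯ := by
  have hp : p.Prime := Fact.out
  have hxm : (X ^ p - C (⟨x ^ p, hx⟩ : L)).Monic := monic_X_pow_sub_C _ hp.ne_zero
  have hxr : aeval x (X ^ p - C (⟨x ^ p, hx⟩ : L)) = 0 := by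
    rw [map_sub, map_pow, aeval_X, aeval_C]
    exact sub_self _
  have hxi : IsIntegral L x := ⟨_, hxm, hxr⟩
  have hzr : aeval z (X ^ p - C (⟨z ^ p, hz⟩ : L)) = 0 := by
    rw [map_sub, map_pow, aeval_X, aeval_C]
    exact sub_self _
  have hzm : (X ^ p - C (⟨z ^ p, hz⟩ : L)).Monic := monic_X_pow_sub_C _ hp.ne_zero
  have hirr : Irreducible (X ^ p - C (⟨z ^ p, hz⟩ : L)) := by
    refine X_pow_sub_C_irreducible_of_prime hp fun b hb => hzL ?_
    have hb' : (b : F) ^ p = z ^ p := congrArg Subtype.val hb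
    rw [← frobenius_inj F p hb']
    exact b.2
  have hzi : IsIntegral L z := ⟨_, hzm, hzr⟩
  have hfin : FiniteDimensional L L⟮x⟯ := adjoin.finiteDimensional hxi
  have heq : L⟮z⟯ = L⟮x⟯ := by
    refine eq_of_le_of_finrank_le (adjoin_simple_le_iff.2 hzx) ?_
    rw [adjoin.finrank hxi, adjoin.finrank hzi, ← minpoly.eq_of_irreducible_of_monic hirr hzr hzm,
      natDegree_X_pow_sub_C]
    exact (natDegree_le_of_dvd (minpoly.dvd L x hxr) hxm.ne_zero).trans
      natDegree_X_pow_sub_C.le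
  rw [heq]
  exact mem_adjoin_simple_self L x

theorem exists_pow_mem_sepCl (hb : ∃ x : Fin 1 → F, IsTranscendenceBasis k x)
    {x : F} (hx : x ∉ Set.range (algebraMap k F)) (y : F) :
    ∃ n, y ^ p ^ n ∈ sepCl k x := by
  have := isAlgebraic_adjoin_of_notMem_range hb hx
  obtain ⟨n, a, ha⟩ := IsPurelyInseparable.pow_mem (separableClosure k⟮x⟯ F) p y
  exact ⟨n, ha ▸ a.2⟩

/-- If `z` is separable over `k(x)` and is not a `p`-th power there, then `x` is separable
over `k(z)`. -/
theorem mem_sepCl_of_forall_pow_ne (hb : ∃ x : Fin 1 → F, IsTranscendenceBasis k x)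
    {x z : F} (hz : z ∉ Set.range (algebraMap k F))
    (hzx : z ∈ sepCl k x) (hpow : ∀ s ∈ sepCl k x, s ^ p ≠ z) : x ∈ sepCl k z := by
  have hgen := sepCl_le_adjoin_frobenius p (x := x) (k := k)
  set L := (sepCl k x).toSubfield.map (frobenius F p)
  have hxz : x ∈ L⟮z⟯ := by
    refine mem_adjoin_of_pow_mem_of_notMem p ⟨x, self_mem_sepCl x, rfl⟩ ⟨z, hzx, rfl⟩ ?_
      (hgen z hzx)
    rintro ⟨s, hs, hsz⟩
    exact hpow s hs hsz
  have hgenz : ∀ s ∈ sepCl k x, s ∈ L⟮z⟯ := fun s hs =>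
    (adjoin_simple_le_iff.2 hxz : L⟮x⟯ ≤ L⟮z⟯) (hgen s hs)
  obtain ⟨n, hn⟩ := exists_pow_mem_sepCl p hb hz x
  have key : ∀ m ≤ n, ∀ s ∈ sepCl k x, s ^ p ^ (n - m) ∈ sepCl k z := by
    intro m
    induction m with
    | zero => exact fun _ s hs => sepCl_le_of_mem hn (pow_mem_sepCl p n hs)
    | succ m ih =>
      intro hm s hs
      have ih := ih (by omega)
      obtain ⟨j, hj⟩ : ∃ j, n - m = j + 1 := ⟨n - m - 1, by omega⟩
      have hj' : n - (m + 1) = j := by omega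
      rw [hj] at ih
      rw [hj']
      have hsz := hgenz s hs
      clear hs
      induction hsz using adjoin_induction with
      | mem y hy =>
        rw [Set.mem_singleton_iff.1 hy]
        exact pow_mem (self_mem_sepCl z) _
      | algebraMap a =>
        obtain ⟨a, t, ht, rfl⟩ := a
        have := ih t ht
        rw [pow_succ', pow_mul] at this
        exact this
      | add a b _ _ ha hb => rw [add_pow_char_pow]; exact add_mem ha hb
      | inv a _ ha => rw [inv_pow]; exact inv_mem ha
      | mul a b _ _ ha hb => rw [mul_pow]; exact mul_mem ha hb
  simpa using key n le_rfl x (self_mem_sepCl x)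

end PositiveCharacteristic

section OrbitContainedInSeparableClosure

variable {k F : Type*} [Field k] [Field F] [Algebra k F] [IsAlgClosed k]

theorem apply_mem_sepCl_of_isCompact (p : ℕ) [Fact p.Prime] [CharP F p]
    (hb : ∃ x : Fin 1 → F, IsTranscendenceBasis k x)
    {K : Subgroup (F ≃ₐ[k] F)}
    (hK : @IsCompact _ (autTop k F) (K : Set (F ≃ₐ[k] F))) {σ : F ≃ₐ[k] F} (hσ : σ ∈ K) {x : F}
    (hx : x ∉ Set.range (algebraMap k F)) : σ x ∈ sepCl k x := by
  classical
  by_contra hnot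
  have hex := exists_pow_mem_sepCl p hb hx (σ x)
  obtain ⟨n, hn⟩ : ∃ n, Nat.find hex = n + 1 := by
    refine Nat.exists_eq_succ_of_ne_zero fun h0 => hnot ?_
    simpa [h0] using Nat.find_spec hex
  have hmem := Nat.find_spec hex
  have hmin := Nat.find_min hex (m := n) (by omega)
  rw [hn] at hmem
  have hσx : σ x ∉ Set.range (algebraMap k F) := by
    rintro ⟨a, ha⟩
    exact hx ⟨a, σ.injective (by rw [σ.commutes, ha])⟩
  have hp : p.Prime := Fact.out
  have hxq : x ∈ sepCl k (σ x ^ p ^ (n + 1)) := by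
    refine mem_sepCl_of_forall_pow_ne p hb (pow_notMem_range hσx (pow_pos hp.pos _)) hmem ?_
    intro s hs hpow
    rw [pow_succ, pow_mul] at hpow
    rw [frobenius_inj F p hpow] at hs
    exact hmin hs
  have key : ∀ i, x ∈ sepCl k ((σ ^ i) x ^ p ^ ((n + 1) * i)) := by
    intro i
    induction i with
    | zero => simpa using self_mem_sepCl x
    | succ i ih =>
      have h := pow_mem_sepCl p ((n + 1) * i) (algEquiv_mem_sepCl (σ ^ i) hxq)
      rw [map_pow, ← AlgEquiv.mul_apply, ← pow_succ, ← pow_mul, ← pow_add,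
        add_comm (n + 1), ← Nat.mul_succ] at h
      exact sepCl_le_of_mem h ih
  obtain ⟨N, hN, hfix⟩ := exists_pow_apply_eq_of_isCompact hK hσ x
  have h := key N
  rw [hfix] at h
  exact notMem_sepCl_pow p hx (by positivity) h

theorem apply_mem_sepCl_of_mem_Gcirc (p : ℕ) [Fact p.Prime] [CharP F p]
    (hb : ∃ x : Fin 1 → F, IsTranscendenceBasis k x)
    {σ : F ≃ₐ[k] F} (hσ : σ ∈ Gcirc k F) :
    ∀ x ∉ Set.range (algebraMap k F), σ x ∈ sepCl k x ∧ σ⁻¹ x ∈ sepCl k x := by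
  have hrange : ∀ (τ : F ≃ₐ[k] F) {x : F}, x ∉ Set.range (algebraMap k F) →
      τ x ∉ Set.range (algebraMap k F) := by
    rintro τ x hx ⟨a, ha⟩
    exact hx ⟨a, τ.injective (by rw [τ.commutes, ha])⟩
  induction hσ using Subgroup.closure_induction with
  | mem σ h =>
    obtain ⟨K, hK, hσ⟩ := h
    exact fun x hx => ⟨apply_mem_sepCl_of_isCompact p hb hK hσ hx,
      apply_mem_sepCl_of_isCompact p hb hK (inv_mem hσ) hx⟩
  | one => exact fun x _ => ⟨self_mem_sepCl x, by simpa using self_mem_sepCl x⟩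
  | mul σ τ _ _ hσ hτ =>
    intro x hx
    refine ⟨sepCl_le_of_mem (hτ x hx).1 (hσ _ (hrange τ hx)).1, ?_⟩
    rw [mul_inv_rev]
    exact sepCl_le_of_mem (hσ x hx).2 (hτ _ (hrange σ⁻¹ hx)).2
  | inv σ _ hσ => exact fun x hx => ⟨(hσ x hx).2, by simpa using (hσ x hx).1⟩

end OrbitContainedInSeparableClosure

section SeparableClosureContainedInOrbitField

variable {k F : Type*} [Field k] [Field F] [Algebra k F] [IsAlgClosed k] [IsAlgClosed F]

/-- Translations `w ↦ w + b` extend to automorphisms of `F` in `G°`: they fix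
`w ^ p - b ^ (p - 1) * w`. -/
theorem exists_mem_Gcirc_apply_eq_add (p : ℕ) [Fact p.Prime] [CharP F p]
    (hb : ∃ x : Fin 1 → F, IsTranscendenceBasis k x) {w : F}
    (hw : w ∉ Set.range (algebraMap k F)) (b : k) :
    ∃ σ ∈ Gcirc k F, σ w = w + algebraMap k F b := by
  have hp : p.Prime := Fact.out
  have hwb : w + algebraMap k F b ∉ Set.range (algebraMap k F) := by
    rintro ⟨a, ha⟩
    exact hw ⟨a - b, by rw [map_sub, ha, add_sub_cancel_right]⟩
  obtain ⟨σ, hσ⟩ := exists_algEquiv_apply_eq hb hw hwb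
  have ht : w ^ p - algebraMap k F (b ^ (p - 1)) * w ∉ Set.range (algebraMap k F) := by
    rintro ⟨a, ha⟩
    have hmonic : (X ^ p - (C (b ^ (p - 1)) * X + C a)).Monic :=
      monic_X_pow_sub (degree_linear_le.trans_lt (by exact_mod_cast hp.one_lt))
    refine transcendental_of_notMem_range hw ⟨_, hmonic.ne_zero, ?_⟩
    simp only [map_sub, map_add, map_mul, aeval_X, aeval_C, map_pow] at ha ⊢
    rw [ha]
    ring
  have := isAlgebraic_adjoin_of_notMem_range hb ht
  refine ⟨σ, mem_Gcirc_of_apply_eq (t := w ^ p - algebraMap k F (b ^ (p - 1)) * w) ?_, hσ⟩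
  have hpow : algebraMap k F (b ^ (p - 1)) * algebraMap k F b = algebraMap k F b ^ p := by
    rw [← map_mul, ← pow_succ, Nat.sub_add_cancel hp.one_le, map_pow]
  rw [map_sub, map_mul, map_pow, hσ, σ.commutes, add_pow_char, mul_add, hpow]
  ring

/-- A subfield stable under `G°` and strictly larger than `k` meets each `k(w)` outside `k`. -/
theorem exists_mem_adjoin_of_Gcirc_stable (hb : ∃ x : Fin 1 → F, IsTranscendenceBasis k x)
    {H : IntermediateField k F} (hH : ∀ σ ∈ Gcirc k F, ∀ y ∈ H, σ y ∈ H) {x : F} (hxH : x ∈ H)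
    (hx : x ∉ Set.range (algebraMap k F)) {w : F} (hw : w ∉ Set.range (algebraMap k F)) :
    ∃ v ∈ H, v ∈ k⟮w⟯ ∧ v ∉ Set.range (algebraMap k F) := by
  have := isAlgebraic_adjoin_of_notMem_range hb hw
  have := normal_adjoin_of_notMem_range hb hw
  have hint : IsIntegral k⟮w⟯ x := Algebra.IsIntegral.isIntegral x
  set P := (minpoly k⟮w⟯ x).map (algebraMap k⟮w⟯ F) with hP
  have hmonic : P.Monic := (minpoly.monic hint).map _
  have hlift : P ∈ lifts (algebraMap H F) := by
    refine (IsAlgClosed.splits P).mem_lift_of_roots_mem_range hmonic _ fun r hr => ?_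
    have hr' : aeval r (minpoly k⟮w⟯ x) = 0 := by
      rw [← eval_map_algebraMap]
      exact isRoot_of_mem_roots hr
    obtain ⟨σ, hσ⟩ := isConjRoot_iff_exists_algEquiv.1
      ((isConjRoot_iff_aeval_eq_zero hint).2 hr').symm
    have hmem := hH (σ.restrictScalars k) (mem_Gcirc_of_apply_eq (t := w)
      (σ.commutes ⟨w, mem_adjoin_simple_self k w⟩)) x hxH
    exact ⟨⟨r, hσ ▸ hmem⟩, rfl⟩
  by_contra! hcon
  have hk : P ∈ lifts (algebraMap k F) := by
    rw [lifts_iff_coeff_lifts] at hlift ⊢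
    intro i
    obtain ⟨h, hh⟩ := hlift i
    refine hcon _ (hh ▸ h.2) ?_
    rw [hP, coeff_map]
    exact ((minpoly k⟮w⟯ x).coeff i).2
  obtain ⟨Q, hQ⟩ := (mem_lifts P).1 hk
  refine transcendental_of_notMem_range hx ⟨Q, ?_, ?_⟩
  · rintro rfl
    rw [Polynomial.map_zero] at hQ
    exact hmonic.ne_zero hQ.symm
  · rw [← eval_map_algebraMap, hQ, hP, eval_map_algebraMap, minpoly.aeval]

/-- An automorphism of `F` over a `G°`-stable subfield larger than `k` moves every element of `F`
by an element of `k`. -/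
theorem apply_sub_mem_range_of_Gcirc_stable (p : ℕ) [Fact p.Prime] [CharP F p]
    (hb : ∃ x : Fin 1 → F, IsTranscendenceBasis k x)
    {H : IntermediateField k F} (hH : ∀ σ ∈ Gcirc k F, ∀ y ∈ H, σ y ∈ H) {x : F} (hxH : x ∈ H)
    (hx : x ∉ Set.range (algebraMap k F)) (τ : F ≃ₐ[H] F) {w : F}
    (hw : w ∉ Set.range (algebraMap k F)) : τ w - w ∈ Set.range (algebraMap k F) := by
  obtain ⟨v, hvH, hvw, hv⟩ := exists_mem_adjoin_of_Gcirc_stable hb hH hxH hx hw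
  obtain ⟨f, g, rfl⟩ := (mem_adjoin_simple_iff k v).1 hvw
  by_contra hc
  have hinj : Function.Injective (algebraMap k F) := (algebraMap k F).injective
  have hg0 : g ≠ 0 := by
    rintro rfl
    exact hv ⟨0, by simp⟩
  have hne : ∀ {y : F}, y ∉ Set.range (algebraMap k F) → ∀ {h : k[X]}, h ≠ 0 → aeval y h ≠ 0 :=
    fun hy _ hh h0 => transcendental_of_notMem_range hy ⟨_, hh, h0⟩
  have hadd : ∀ {y : F}, y ∉ Set.range (algebraMap k F) → ∀ b : k,
      y + algebraMap k F b ∉ Set.range (algebraMap k F) := by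
    rintro y hy b ⟨a, ha⟩
    exact hy ⟨a - b, by rw [map_sub, ha, add_sub_cancel_right]⟩
  have hτk : ∀ a : k, τ (algebraMap k F a) = algebraMap k F a := (τ.restrictScalars k).commutes
  have hτw : τ w ∉ Set.range (algebraMap k F) := by
    rintro ⟨a, ha⟩
    exact hw ⟨a, τ.injective (by rw [hτk, ha])⟩
  have hτae : ∀ (y : F) (h : k[X]), τ (aeval y h) = aeval (τ y) h := fun y h =>
    (aeval_algHom_apply (τ.restrictScalars k) y h).symm
  have heval : ∀ b : k, aeval (w + algebraMap k F b) f * aeval (τ w + algebraMap k F b) g =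
      aeval (τ w + algebraMap k F b) f * aeval (w + algebraMap k F b) g := by
    intro b
    obtain ⟨σ, hσ, hσw⟩ := exists_mem_Gcirc_apply_eq_add p hb hw b
    have hmem := hH σ hσ _ hvH
    rw [map_div₀, ← aeval_algHom_apply, ← aeval_algHom_apply, hσw] at hmem
    have hfix := τ.commutes ⟨_, hmem⟩
    change τ (_ / _) = _ / _ at hfix
    rw [map_div₀, hτae, hτae, map_add, hτk,
      div_eq_div_iff (hne (hadd hτw b) hg0) (hne (hadd hw b) hg0)] at hfix
    exact hfix.symm
  have hpoly : (f.map (algebraMap k F)).comp (C w + X) * (g.map (algebraMap k F)).comp (C (τ w) + X)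
      = (f.map (algebraMap k F)).comp (C (τ w) + X) * (g.map (algebraMap k F)).comp (C w + X) := by
    have : Infinite k := IsAlgClosed.instInfinite
    refine eq_of_infinite_eval_eq _ _ ((Set.infinite_range_of_injective hinj).mono ?_)
    rintro _ ⟨b, rfl⟩
    simpa [eval_comp] using heval b
  obtain ⟨a, ha⟩ : ∃ a : k, g.eval a ≠ 0 := by
    have : Infinite k := IsAlgClosed.instInfinite
    by_contra! h
    exact hg0 (funext fun a => by rw [h a, eval_zero])
  have hshift : C (f.eval a) * g.comp (X + C a) = C (g.eval a) * f.comp (X + C a) := by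
    refine transcendental_iff_injective.1 (transcendental_of_notMem_range hc) ?_
    have h := congrArg (eval (algebraMap k F a - w)) hpoly
    simp only [eval_mul, eval_comp, eval_add, eval_C, eval_X, add_sub_cancel, eval_map_algebraMap,
      aeval_algebraMap_apply_eq_algebraMap_eval] at h
    simp only [map_mul, aeval_C, aeval_comp, map_add, aeval_X]
    rw [show τ w - w + algebraMap k F a = τ w + (algebraMap k F a - w) by ring, h, mul_comm]
  have hfg : C (f.eval a) * g = C (g.eval a) * f := by
    have h := congrArg (fun q => q.comp (X - C a)) hshift
    simpa [mul_comp, comp_assoc] using h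
  refine hv ⟨f.eval a / g.eval a, ?_⟩
  have h := congrArg (aeval w) hfg
  simp only [map_mul, aeval_C] at h
  rw [map_div₀, div_eq_div_iff (by simpa using ha) (hne hw hg0), h, mul_comm]

theorem apply_eq_of_Gcirc_stable (p : ℕ) [Fact p.Prime] [CharP F p]
    (hb : ∃ x : Fin 1 → F, IsTranscendenceBasis k x)
    {H : IntermediateField k F} (hH : ∀ σ ∈ Gcirc k F, ∀ y ∈ H, σ y ∈ H) {x : F} (hxH : x ∈ H)
    (hx : x ∉ Set.range (algebraMap k F)) (τ : F ≃ₐ[H] F) (w : F) : τ w = w := by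
  by_cases hw : w ∈ Set.range (algebraMap k F)
  · obtain ⟨a, rfl⟩ := hw
    exact (τ.restrictScalars k).commutes a
  have hw0 : w ≠ 0 := by
    rintro rfl
    exact hw ⟨0, map_zero _⟩
  have hwi : w⁻¹ ∉ Set.range (algebraMap k F) := by
    rintro ⟨a, ha⟩
    exact hw ⟨a⁻¹, by rw [map_inv₀, ha, inv_inv]⟩
  obtain ⟨c, hc⟩ := apply_sub_mem_range_of_Gcirc_stable p hb hH hxH hx τ hw
  obtain ⟨d, hd⟩ := apply_sub_mem_range_of_Gcirc_stable p hb hH hxH hx τ hwi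
  rw [eq_sub_iff_add_eq] at hc hd
  have hmul : (algebraMap k F c + w) * (algebraMap k F d + w⁻¹) = 1 := by
    rw [hc, hd, map_inv₀, mul_inv_cancel₀ (by simpa using hw0)]
  have hzero : aeval w (C d * X ^ 2 + C (c * d) * X + C c) = 0 := by
    simp only [map_add, map_mul, aeval_C, aeval_X, map_pow]
    field_simp at hmul
    linear_combination hmul
  have hpoly : C d * X ^ 2 + C (c * d) * X + C c = 0 :=
    (transcendental_iff.1 (transcendental_of_notMem_range hw)) _ hzero
  have hc0 : c = 0 := by simpa using congrArg (fun q => q.coeff 0) hpoly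
  rw [← hc, hc0, map_zero, zero_add]

theorem sepCl_le_of_Gcirc_stable (p : ℕ) [Fact p.Prime] [CharP F p]
    (hb : ∃ x : Fin 1 → F, IsTranscendenceBasis k x)
    {H : IntermediateField k F} (hH : ∀ σ ∈ Gcirc k F, ∀ y ∈ H, σ y ∈ H) {x : F} (hxH : x ∈ H)
    (hx : x ∉ Set.range (algebraMap k F)) : sepCl k x ≤ H := by
  intro y hy
  have hle : k⟮x⟯ ≤ H := adjoin_simple_le_iff.2 hxH
  have hsep : IsSeparable H y :=
    (mem_sepCl.1 hy).map_of_mapsTo (RingHom.id F) (fun a ha => hle ha)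
  have := isAlgebraic_adjoin_of_notMem_range hb hx
  have halg : Algebra.IsAlgebraic H F := by
    let := (inclusion hle).toAlgebra
    have : IsScalarTower k⟮x⟯ H F := IsScalarTower.of_algebraMap_eq fun _ => rfl
    exact Algebra.IsAlgebraic.tower_top (K := k⟮x⟯) H
  have : IsAlgClosure H F := ⟨inferInstance, halg⟩
  have : Normal H F := IsAlgClosure.normal _ _
  by_contra hyH
  have hbot : y ∉ (⊥ : Subalgebra H F) := by
    rintro ⟨a, rfl⟩
    exact hyH a.2
  obtain ⟨z, hyz, hconj⟩ := (notMem_iff_exists_ne_and_isConjRoot hsep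
    (IsAlgClosed.splits _)).1 hbot
  obtain ⟨τ, hτ⟩ := isConjRoot_iff_exists_algEquiv.1 hconj
  exact hyz (hτ.symm.trans (apply_eq_of_Gcirc_stable p hb hH hxH hx τ z))

end SeparableClosureContainedInOrbitField

end

/-- Let `F/k` be an extension of algebraically closed fields of characteristic
`p > 0` and transcendence degree 1.  For every `x ∈ F ∖ k`, the subfield of `F`
generated by the `G°`-orbit of `x` is the separable closure of `k(x)` in `F`. -/
theorem statement15 (k F : Type*) [Field k] [Field F] [Algebra k F]
    [IsAlgClosed k] [IsAlgClosed F]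
    (p : ℕ) [Fact p.Prime] [CharP F p]
    (hb : ∃ x : Fin 1 → F, IsTranscendenceBasis k x)
    (x : F) (hx : x ∉ Set.range (algebraMap k F)) :
    Subfield.closure {y : F | ∃ σ ∈ Gcirc k F, σ x = y} =
      (separableClosure ↥(IntermediateField.adjoin k {x}) F).toSubfield := by
  have hxorb : x ∈ {y : F | ∃ σ ∈ Gcirc k F, σ x = y} := ⟨1, one_mem _, rfl⟩
  apply le_antisymm
  · rw [Subfield.closure_le]
    rintro _ ⟨σ, hσ, rfl⟩
    exact (apply_mem_sepCl_of_mem_Gcirc p hb hσ x hx).1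
  · have hk : ∀ a : k, algebraMap k F a ∈
        Subfield.closure {y : F | ∃ σ ∈ Gcirc k F, σ x = y} := by
      intro a
      obtain ⟨σ, hσ, hσx⟩ := exists_mem_Gcirc_apply_eq_add p hb hx a
      rw [← add_sub_cancel_left x (algebraMap k F a), ← hσx]
      exact sub_mem (Subfield.subset_closure ⟨σ, hσ, rfl⟩) (Subfield.subset_closure hxorb)
    let H : IntermediateField k F :=
      (Subfield.closure {y : F | ∃ σ ∈ Gcirc k F, σ x = y}).toIntermediateField hk
    have hstable : ∀ σ ∈ Gcirc k F, ∀ y ∈ H, σ y ∈ H := by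
      intro σ hσ y hy
      have hle : Subfield.closure {y : F | ∃ σ ∈ Gcirc k F, σ x = y} ≤
          (Subfield.closure {y : F | ∃ σ ∈ Gcirc k F, σ x = y}).comap (σ : F →+* F) := by
        rw [Subfield.closure_le]
        rintro _ ⟨τ, hτ, rfl⟩
        exact Subfield.subset_closure ⟨σ * τ, mul_mem hσ hτ, rfl⟩
      exact hle hy
    exact sepCl_le_of_Gcirc_stable p hb hstable (Subfield.subset_closure hxorb) hx
end

section
/- Let x ∈ F be transcendental over k such that σ(x) is algebraic over the subfield k(x), and suppose that σ^N(x) = x for some integer N ≥ 1. Then k(x, σ(x)) is a separable field extension of k(x). -/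
open IntermediateField

lemma IsSeparable.map_adjoin_singleton {k K L : Type*} [Field k] [Field K] [Field L]
    [Algebra k K] [Algebra k L] (f : K →ₐ[k] L) {a b : K} (h : IsSeparable k⟮a⟯ b) :
    IsSeparable k⟮f a⟯ (f b) := by
  have hmem (z : k⟮a⟯) : f z ∈ k⟮f a⟯ := by
    rw [← Set.image_singleton, ← adjoin_map]
    exact ⟨z, z.2, rfl⟩
  let g : k⟮a⟯ →+* k⟮f a⟯ := (f.toRingHom.comp (algebraMap k⟮a⟯ K)).codRestrict _ hmem
  refine (Polynomial.Separable.map (f := g) h).of_dvd (minpoly.dvd _ _ ?_)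
  have hg : (algebraMap k⟮f a⟯ L).comp g = (f : K →+* L).comp (algebraMap k⟮a⟯ K) := rfl
  rw [Polynomial.aeval_def, Polynomial.eval₂_map, hg]
  have := congrArg (f : K →+* L) (minpoly.aeval k⟮a⟯ b)
  rwa [Polynomial.aeval_def, Polynomial.hom_eval₂, map_zero] at this

lemma IsSeparable.trans_adjoin_singleton {k F : Type*} [Field k] [Field F] [Algebra k F]
    {a b c : F} (hab : IsSeparable k⟮b⟯ a) (hbc : IsSeparable k⟮c⟯ b) :
    IsSeparable k⟮c⟯ a := by
  have hle : k⟮b⟯ ≤ (separableClosure k⟮c⟯ F).restrictScalars k := by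
    rw [adjoin_simple_le_iff]
    exact hbc
  exact (separableClosure_le_separableClosure_iff k F k⟮c⟯).2 hle hab

lemma isSeparable_or_isSeparable_of_isAlgebraic {k K : Type*} [Field k] [Field K] [Algebra k K]
    (p : ℕ) [Fact p.Prime] [CharP k p] [PerfectField k] {x : K} (htr : Transcendental k x)
    [Algebra.IsAlgebraic k⟮x⟯ K] (y : K) :
    IsSeparable k⟮x⟯ y ∨ IsSeparable k⟮y⟯ x := by
  have hp : p.Prime := Fact.out
  have : ExpChar k p := .prime hp
  have : CharP K p := .of_ringHom_of_ne_zero (algebraMap k K) p hp.ne_zero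
  let a : Bool → K := fun i ↦ if i then y else x
  let : Unique {i : Bool // i ≠ true} := ⟨⟨⟨false, by simp⟩⟩, by rintro ⟨_ | _, h⟩ <;> simp_all⟩
  have hb : IsTranscendenceBasis k fun i : {i : Bool // i ≠ true} ↦ a i := by
    rw [isTranscendenceBasis_iff_algebraicIndependent_isAlgebraic,
      algebraicIndependent_unique_type_iff]
    refine ⟨htr, ?_⟩
    have : Set.range (fun i : {i : Bool // i ≠ true} ↦ a i) = {x} := by
      rw [Set.range_unique]; rfl
    rw [this, ← isAlgebraic_adjoin_iff_top]
    infer_instance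
  have hpow (s : Finset K) (hs : LinearIndepOn k _root_.id (s : Set K)) :
      LinearIndepOn k (· ^ p) (s : Set K) := by
    refine hs.map_of_injective_injective (frobeniusEquiv k p).symm
      (frobenius K p).toAddMonoidHom (by simp) (by simp) fun c m ↦ ?_
    change ((frobeniusEquiv k p).symm c • m) ^ p = c • m ^ p
    rw [smul_pow, frobeniusEquiv_symm_pow_p]
  obtain ⟨i, -, hi⟩ :=
    exists_isTranscendenceBasis_and_isSeparable_of_linearIndepOn_pow p hp hpow true hb
  cases i
  · right
    have : a '' {false}ᶜ = {y} := by simp [Bool.compl_singleton, a, Set.image_singleton]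
    rwa [this] at hi
  · left
    have : a '' {true}ᶜ = {x} := by simp [a]
    rwa [this] at hi

lemma isSeparable_or_isSeparable_of_isAlgebraic_adjoin {k F : Type*} [Field k] [Field F]
    [Algebra k F] (p : ℕ) [Fact p.Prime] [CharP k p] [PerfectField k] {x y : F}
    (htr : Transcendental k x) (halg : IsAlgebraic k⟮x⟯ y) :
    IsSeparable k⟮x⟯ y ∨ IsSeparable k⟮y⟯ x := by
  let K := k⟮x⟯⟮y⟯
  let f : K →ₐ[k] F := K.val.restrictScalars k
  let x' : K := algebraMap k⟮x⟯ K (AdjoinSimple.gen k x)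
  let y' : K := AdjoinSimple.gen k⟮x⟯ y
  have halgK : Algebra.IsAlgebraic k⟮x⟯ K := isAlgebraic_adjoin_simple halg.isIntegral
  have hmem (z : k⟮x⟯) : algebraMap k⟮x⟯ K z ∈ k⟮x'⟯ := by
    have hz : (z : F) ∈ k⟮x'⟯.map f := by
      rw [adjoin_map, Set.image_singleton]
      exact z.2
    obtain ⟨w, hw, hwz⟩ := hz
    rwa [show algebraMap k⟮x⟯ K z = w from Subtype.ext hwz.symm]
  have : Algebra.IsAlgebraic k⟮x'⟯ K :=
    halgK.ringHom_of_comp_eq ((algebraMap k⟮x⟯ K).codRestrict _ hmem) (RingHom.id K)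
      (RingHom.injective _) Function.surjective_id rfl
  have htr' : Transcendental k x' := fun h ↦ htr (h.algHom f)
  exact (isSeparable_or_isSeparable_of_isAlgebraic p htr' y').imp
    (·.map_adjoin_singleton f) (·.map_adjoin_singleton f)

/-- Let `k` be an algebraically closed field of characteristic `p > 0`, `F/k` a
field extension and `σ` an automorphism of `F` over `k`.  If `x ∈ F` is
transcendental over `k`, `σ(x)` is algebraic over `k(x)`, and `σ^N(x) = x` for
some `N ≥ 1`, then `k(x, σ(x))` is a separable extension of `k(x)`. -/
theorem statement16 (k F : Type*) [Field k] [Field F] [Algebra k F]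
    [IsAlgClosed k]
    (p : ℕ) [Fact p.Prime] [CharP k p]
    (σ : F ≃ₐ[k] F) (x : F)
    (htr : Transcendental k x)
    (halg : IsAlgebraic ↥(IntermediateField.adjoin k {x}) (σ x))
    (N : ℕ) (hN : 1 ≤ N) (hfix : (σ ^ N) x = x) :
    Algebra.IsSeparable ↥(IntermediateField.adjoin k {x})
      ↥(IntermediateField.adjoin ↥(IntermediateField.adjoin k {x}) {σ x}) := by
  rw [isSeparable_adjoin_simple_iff_isSeparable]
  rcases isSeparable_or_isSeparable_of_isAlgebraic_adjoin p htr halg with h | h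
  · exact h
  have hstep (n : ℕ) : IsSeparable k⟮(σ ^ (n + 1)) x⟯ ((σ ^ n) x) := by
    have := h.map_adjoin_singleton (σ ^ n : F ≃ₐ[k] F).toAlgHom
    rwa [pow_succ]
  have hchain (n : ℕ) : IsSeparable k⟮(σ ^ (n + 1)) x⟯ (σ x) := by
    induction n with
    | zero => exact isSeparable_algebraMap (AdjoinSimple.gen k (σ x))
    | succ n ih => exact ih.trans_adjoin_singleton (hstep (n + 1))
  obtain ⟨n, rfl⟩ := Nat.exists_eq_add_of_le' hN
  have hsep := hchain n
  rwa [hfix] at hsep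
end

section
/- Suppose trdeg(F/k) = n with 1 ≤ n < ∞. Then every G-equivariant ℚ-linear map Ω^n_F → F is zero, i.e., Hom_G(Ω^n_F, F) = 0. -/
/-- The wedge `v 0 ∧ … ∧ v (n-1)` as an element of the `n`-th exterior power. -/
noncomputable def wedge (R M : Type*) [CommRing R] [AddCommGroup M] [Module R M]
    (n : ℕ) (v : Fin n → M) : ↥(⋀[R]^n M) :=
  ⟨ExteriorAlgebra.ιMulti R n v, ExteriorAlgebra.ιMulti_range R n ⟨v, rfl⟩⟩

section TrdegOne

open Polynomial IntermediateField

variable {L F : Type*} [Field L] [Field F] [Algebra L F]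

theorem isTranscendenceBasis_of_trdeg_eq_one (htr : Algebra.trdeg L F = 1) {u : F}
    (hu : Transcendental L u) : IsTranscendenceBasis L (fun _ : Unit => u) :=
  (algebraicIndependent_unique_type_iff.2 hu).isTranscendenceBasis_of_lift_trdeg_le_of_finite
    (by simp [htr])

theorem isAlgebraic_adjoin_of_trdeg_eq_one (htr : Algebra.trdeg L F = 1) {u : F}
    (hu : Transcendental L u) : Algebra.IsAlgebraic L⟮u⟯ F := by
  have := (isTranscendenceBasis_of_trdeg_eq_one htr hu).isAlgebraic_field
  rwa [Set.range_const] at this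

theorem IsTranscendenceBasis.exists_algEquiv [IsAlgClosed F] {ι : Type*} {x y : ι → F}
    (hx : IsTranscendenceBasis L x) (hy : IsTranscendenceBasis L y) :
    ∃ σ : F ≃ₐ[L] F, ∀ i, σ (x i) = y i := by
  let := IsAlgClosed.isAlgClosure_of_transcendence_basis x hx
  let := IsAlgClosed.isAlgClosure_of_transcendence_basis y hy
  let e : Algebra.adjoin L (Set.range x) ≃ₐ[L] Algebra.adjoin L (Set.range y) :=
    hx.1.aevalEquiv.symm.trans hy.1.aevalEquiv
  let τ : F ≃+* F := IsAlgClosure.equivOfEquiv F F e.toRingEquiv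
  have hτ (s : Algebra.adjoin L (Set.range x)) : τ s = e s :=
    IsAlgClosure.equivOfEquiv_algebraMap F F e.toRingEquiv s
  refine ⟨AlgEquiv.ofRingEquiv (f := τ) fun c => ?_, fun i => ?_⟩
  · have h := hτ (algebraMap L _ c)
    rw [e.commutes] at h
    exact h
  · have h := hτ (hx.1.aevalEquiv (MvPolynomial.X i))
    simpa [e] using h

theorem exists_algEquiv_of_transcendental [IsAlgClosed F] (htr : Algebra.trdeg L F = 1) {u v : F}
    (hu : Transcendental L u) (hv : Transcendental L v) : ∃ σ : F ≃ₐ[L] F, σ u = v :=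
  let ⟨σ, hσ⟩ := (isTranscendenceBasis_of_trdeg_eq_one htr hu).exists_algEquiv
    (isTranscendenceBasis_of_trdeg_eq_one htr hv)
  ⟨σ, hσ ()⟩

theorem transcendental_of_notMem_range_s18 [IsAlgClosed L] {h : F}
    (hh : h ∉ (algebraMap L F).range) : Transcendental L h := fun h_alg =>
  hh (minpoly.mem_range_of_degree_eq_one L h
    (IsAlgClosed.degree_eq_one_of_irreducible L (minpoly.irreducible h_alg.isIntegral)))

/-- If `σ` has an infinite orbit, then the elements it fixes lie in the base field. -/
theorem mem_range_of_fixed [IsAlgClosed L] (htr : Algebra.trdeg L F = 1) {σ : F ≃ₐ[L] F}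
    {u h : F} {w : ℕ → F} (hw : Function.Injective w) (h_zero : w 0 = u)
    (h_succ : ∀ n, σ (w n) = w (n + 1)) (h_fix : σ h = h) : h ∈ (algebraMap L F).range := by
  by_contra h_notMem
  have h_alg := isAlgebraic_adjoin_of_trdeg_eq_one htr (transcendental_of_notMem_range_s18 h_notMem)
  have h_adj : ∀ z ∈ L⟮h⟯, σ z = z := fun z hz => by
    induction hz using IntermediateField.adjoin_induction with
    | mem x hx => rw [Set.mem_singleton_iff.1 hx, h_fix]
    | algebraMap x => exact σ.commutes x
    | add x y _ _ hx hy => rw [map_add, hx, hy]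
    | inv x _ hx => rw [map_inv₀, hx]
    | mul x y _ _ hx hy => rw [map_mul, hx, hy]
  obtain ⟨p, hp, hpu⟩ := h_alg.isAlgebraic u
  have h_root (n : ℕ) : aeval (w n) p = 0 := by
    induction n with
    | zero => rwa [h_zero]
    | succ n ih =>
      rw [← h_succ, ← map_zero σ, ← ih, aeval_eq_sum_range, aeval_eq_sum_range, map_sum]
      refine Finset.sum_congr rfl fun i _ => ?_
      rw [Algebra.smul_def, Algebra.smul_def, map_mul, map_pow]
      exact congrArg (· * _) (h_adj _ (p.coeff i).2).symm
  exact Set.infinite_of_injective_forall_mem hw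
    (fun n => mem_rootSet.2 ⟨hp, h_root n⟩) (p.rootSet_finite F)

/-- Partial fractions: an additive subgroup containing the monomials in `u` and the elementary
fractions contains `L(u)`. -/
theorem mem_of_mem_adjoin_simple [IsAlgClosed L] {u : F} (hu : Transcendental L u)
    {V : AddSubgroup F} (h_pow : ∀ (c : L) (m : ℕ), c • u ^ m ∈ V)
    (h_inv : ∀ (c a : L) (m : ℕ), c • (u - algebraMap L F a)⁻¹ ^ (m + 1) ∈ V)
    {f : F} (hf : f ∈ L⟮u⟯) : f ∈ V := by
  classical
  let : Algebra L[X] F := (aeval u : L[X] →ₐ[L] F).toAlgebra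
  have hmap (p : L[X]) : algebraMap L[X] F p = aeval u p := rfl
  have h_poly (p : L[X]) : aeval u p ∈ V := by
    rw [aeval_eq_sum_range]
    exact sum_mem fun i _ => h_pow _ _
  have h_ne (a : L) : u - algebraMap L F a ≠ 0 := fun h =>
    hu (sub_eq_zero.1 h ▸ isAlgebraic_algebraMap a)
  obtain ⟨r, s, rfl⟩ := (mem_adjoin_simple_iff L f).1 hf
  obtain ⟨q, t, ht, h_eq⟩ := mul_prod_pow_inverse_eq_quo_add_sum_rem_mul_pow_inverse (K := F)
    (s := s.roots.toFinset) (C s.leadingCoeff⁻¹ * r) (g := fun a => X - C a)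
    (fun a _ => monic_X_sub_C a) (fun a _ b _ hab => isCoprime_X_sub_C_of_isUnit_sub
      (sub_ne_zero.2 hab).isUnit) (fun a => s.roots.count a)
    (gi := fun a => (u - algebraMap L F a)⁻¹)
    (fun a _ => by simp [hmap, inv_mul_cancel₀ (h_ne a)])
  have h_split : aeval u s = algebraMap L F s.leadingCoeff *
      ∏ a ∈ s.roots.toFinset, (u - algebraMap L F a) ^ s.roots.count a := by
    conv_lhs => rw [(IsAlgClosed.splits s).eq_prod_roots]
    simp [Finset.prod_multiset_map_count]
  have : aeval u r / aeval u s = algebraMap L[X] F (C s.leadingCoeff⁻¹ * r) *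
      ∏ a ∈ s.roots.toFinset, (u - algebraMap L F a)⁻¹ ^ s.roots.count a := by
    simp only [h_split, hmap, map_mul, aeval_C, div_eq_mul_inv, mul_inv, ← Finset.prod_inv_distrib,
      inv_pow, map_inv₀]
    ring
  rw [this, h_eq]
  refine add_mem (h_poly q) (sum_mem fun a ha => sum_mem fun j _ => ?_)
  have hdeg := ht a ha j
  rw [degree_X_sub_C] at hdeg
  rw [hmap, eq_C_of_degree_le_zero (Order.le_of_lt_succ (b := 0) hdeg), aeval_C,
    ← Algebra.smul_def]
  exact h_inv _ _ _

/-- If `F` is algebraic over `L(u)`, then `Ω[F⁄ℚ]` is spanned by `D u` and the `D a` for `a`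
in `L`. -/
theorem span_insert_D_eq_top [CharZero F] {u : F} [Algebra.IsAlgebraic L⟮u⟯ F] :
    Submodule.span F (insert (KaehlerDifferential.D ℚ F u)
      (Set.range fun a : L => KaehlerDifferential.D ℚ F (algebraMap L F a))) = ⊤ := by
  set S := Submodule.span F (insert (KaehlerDifferential.D ℚ F u)
    (Set.range fun a : L => KaehlerDifferential.D ℚ F (algebraMap L F a))) with hS
  have h_adj : ∀ z ∈ L⟮u⟯, KaehlerDifferential.D ℚ F z ∈ S := fun z hz => by
    induction hz using IntermediateField.adjoin_induction with
    | mem x hx =>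
      rw [Set.mem_singleton_iff.1 hx]
      exact Submodule.subset_span (Set.mem_insert _ _)
    | algebraMap x => exact Submodule.subset_span (Set.mem_insert_of_mem _ ⟨x, rfl⟩)
    | add x y _ _ hx hy => rw [map_add]; exact S.add_mem hx hy
    | inv x _ hx => rw [Derivation.leibniz_inv]; exact S.smul_mem _ hx
    | mul x y _ _ hx hy =>
      rw [Derivation.leibniz]
      exact S.add_mem (S.smul_mem _ hy) (S.smul_mem _ hx)
  have : CharZero L⟮u⟯ := (algebraMap L⟮u⟯ F).charZero
  have : Algebra.FormallyUnramified L⟮u⟯ F := .of_isSeparable _ _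
  rw [eq_top_iff]
  rintro ω -
  obtain ⟨η, rfl⟩ :=
    (KaehlerDifferential.exact_mapBaseChange_map ℚ L⟮u⟯ F ω).1 (Subsingleton.elim _ _)
  induction η with
  | zero => simp
  | add x y hx hy => rw [map_add]; exact S.add_mem hx hy
  | tmul f η =>
    rw [KaehlerDifferential.mapBaseChange_tmul]
    refine S.smul_mem _ ?_
    have hη : η ∈ Submodule.span L⟮u⟯ (Set.range (KaehlerDifferential.D ℚ L⟮u⟯)) := by
      rw [KaehlerDifferential.span_range_derivation]; trivial
    induction hη using Submodule.span_induction with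
    | mem x hx =>
      obtain ⟨z, rfl⟩ := hx
      rw [KaehlerDifferential.map_D]
      exact h_adj _ z.2
    | zero => simp
    | add x y _ _ hx hy => rw [map_add]; exact S.add_mem hx hy
    | smul c x _ hx =>
      rw [map_smul, ← algebraMap_smul F]
      exact S.smul_mem _ hx

theorem exists_algEquiv_add_one [IsAlgClosed L] [IsAlgClosed F] [CharZero F]
    (htr : Algebra.trdeg L F = 1) {u : F} (hu : Transcendental L u) :
    ∃ σ : F ≃ₐ[L] F, σ u = u + 1 ∧ ∀ h, σ h = h → h ∈ (algebraMap L F).range := by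
  have hu' : Transcendental L (u + 1) := fun h => hu (by
    simpa using h.sub isAlgebraic_one)
  obtain ⟨σ, hσ⟩ := exists_algEquiv_of_transcendental htr hu hu'
  refine ⟨σ, hσ, fun h => mem_range_of_fixed htr (w := fun n => u + n) (u := u) ?_ (by simp) ?_⟩
  · intro m n h
    simpa using h
  · intro n
    simp [hσ, add_assoc, add_comm (1 : F)]

theorem exists_algEquiv_two_mul [IsAlgClosed L] [IsAlgClosed F] [CharZero F]
    (htr : Algebra.trdeg L F = 1) {u : F} (hu : Transcendental L u) :
    ∃ σ : F ≃ₐ[L] F, σ u = 2 * u ∧ ∀ h, σ h = h → h ∈ (algebraMap L F).range := by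
  have h_ne : u ≠ 0 := fun h => hu (h ▸ isAlgebraic_zero)
  have hu' : Transcendental L (2 * u) := fun h => hu (by
    simpa using (isAlgebraic_natCast (R := L) (A := F) 2).inv.mul h)
  obtain ⟨σ, hσ⟩ := exists_algEquiv_of_transcendental htr hu hu'
  refine ⟨σ, hσ, fun h => mem_range_of_fixed htr (w := fun n => 2 ^ n * u) (u := u) ?_ (by simp) ?_⟩
  · intro m n h
    have h2 : (2 : F) ^ m = 2 ^ n := mul_right_cancel₀ h_ne h
    exact Nat.pow_right_injective le_rfl (by exact_mod_cast h2)
  · intro n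
    rw [map_mul, map_pow, map_ofNat, hσ, pow_succ, mul_assoc]

/-- An additive map `Ω[F⁄ℚ] → F` that commutes with the automorphisms of `F` over `L`. -/
def IsEquivariant (L : Type*) {F : Type*} [Field L] [Field F] [Algebra L F] [CharZero F]
    (Ψ : Ω[F⁄ℚ] →+ F) : Prop :=
  ∀ (σ : F ≃ₐ[L] F) (f y : F),
    Ψ (σ f • KaehlerDifferential.D ℚ F (σ y)) = σ (Ψ (f • KaehlerDifferential.D ℚ F y))

namespace IsEquivariant

open KaehlerDifferential

variable [IsAlgClosed L] [IsAlgClosed F] [CharZero F] {Ψ : Ω[F⁄ℚ] →+ F}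

theorem map_algebraMap_smul_D (hΨ : IsEquivariant L Ψ) (htr : Algebra.trdeg L F = 1) (c : L)
    {u : F} (hu : Transcendental L u) : Ψ (algebraMap L F c • D ℚ F u) = 0 := by
  obtain ⟨σ, hσ, hσ_fix⟩ := exists_algEquiv_add_one htr hu
  obtain ⟨τ, hτ, -⟩ := exists_algEquiv_two_mul htr hu
  have h₁ := hΨ σ (algebraMap L F c) u
  rw [hσ, σ.commutes, map_add, Derivation.map_one_eq_zero, add_zero] at h₁
  obtain ⟨b, hb⟩ := hσ_fix _ h₁.symm
  have h₂ := hΨ τ (algebraMap L F c) u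
  rw [hτ, τ.commutes, two_mul, map_add, smul_add, map_add, ← hb, τ.commutes] at h₂
  rw [← hb]
  exact left_eq_add.1 h₂.symm

theorem map_smul_D_algebraMap (hΨ : IsEquivariant L Ψ) (htr : Algebra.trdeg L F = 1) (f : F)
    (b : L) : Ψ (f • D ℚ F (algebraMap L F b)) = 0 := by
  have h_base (c : L) : Ψ (algebraMap L F c • D ℚ F (algebraMap L F b)) = 0 := by
    obtain ⟨u, hu⟩ := (trdeg_ne_zero_iff.1 (htr.trans_ne one_ne_zero)).transcendental
    have hu' : Transcendental L (u + algebraMap L F b) := fun h => hu (by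
      simpa using h.sub (isAlgebraic_algebraMap b))
    have h := hΨ.map_algebraMap_smul_D htr c hu'
    rwa [map_add, smul_add, map_add, hΨ.map_algebraMap_smul_D htr c hu, zero_add] at h
  by_cases hf : f ∈ (algebraMap L F).range
  · obtain ⟨c, rfl⟩ := hf
    exact h_base c
  · have hf := transcendental_of_notMem_range_s18 hf
    obtain ⟨σ, hσ, hσ_fix⟩ := exists_algEquiv_add_one htr hf
    obtain ⟨τ, hτ, -⟩ := exists_algEquiv_two_mul htr hf
    have h₁ := hΨ σ f (algebraMap L F b)
    have h_one := h_base 1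
    rw [map_one] at h_one
    rw [hσ, σ.commutes, add_smul, map_add, h_one, add_zero] at h₁
    obtain ⟨a, ha⟩ := hσ_fix _ h₁.symm
    have h₂ := hΨ τ f (algebraMap L F b)
    rw [hτ, τ.commutes, two_mul, add_smul, map_add, ← ha, τ.commutes] at h₂
    rw [← ha]
    exact left_eq_add.1 h₂.symm

theorem map_pow_smul_D (hΨ : IsEquivariant L Ψ) (htr : Algebra.trdeg L F = 1) (c : L)
    {u : F} (hu : Transcendental L u) (m : ℕ) : Ψ ((c • u ^ m) • D ℚ F u) = 0 := by
  have : CharZero L := (algebraMap L F).charZero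
  have h := hΨ.map_algebraMap_smul_D htr (c / (m + 1)) (hu.pow (Nat.succ_pos m))
  have h_ne : (m + 1 : F) ≠ 0 := by exact_mod_cast Nat.succ_ne_zero m
  rw [Derivation.leibniz_pow, ← Nat.cast_smul_eq_nsmul F, smul_smul, smul_smul] at h
  rw [← h, Algebra.smul_def]
  congr 2
  push_cast [map_div₀, map_add, map_natCast, map_one, Nat.succ_sub_one]
  field_simp

theorem map_inv_smul_D (hΨ : IsEquivariant L Ψ) (htr : Algebra.trdeg L F = 1) (c : L)
    {u : F} (hu : Transcendental L u) : Ψ ((c • u⁻¹) • D ℚ F u) = 0 := by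
  have h_ne : u ≠ 0 := fun h => hu (h ▸ isAlgebraic_zero)
  obtain ⟨τ, hτ, hτ_fix⟩ := exists_algEquiv_two_mul htr hu
  have hu' : Transcendental L u⁻¹ := fun h => hu (by simpa using h.inv)
  obtain ⟨σ, hσ⟩ := exists_algEquiv_of_transcendental htr hu hu'
  have h₁ := hΨ τ (c • u⁻¹) u
  have h_smul : (c • (2 * u)⁻¹) • D ℚ F (2 * u) = (c • u⁻¹) • D ℚ F u := by
    rw [two_mul u, map_add, ← two_smul F (D ℚ F u), smul_smul, smul_mul_assoc]
    congr 2
    field_simp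
    ring
  have hτ_smul : τ (c • u⁻¹) = c • (2 * u)⁻¹ := by
    rw [Algebra.smul_def, map_mul, τ.commutes, map_inv₀, hτ, ← Algebra.smul_def]
  rw [hτ_smul, hτ, h_smul] at h₁
  obtain ⟨a, ha⟩ := hτ_fix _ h₁.symm
  have h₂ := hΨ σ (c • u⁻¹) u
  have h_neg : (c • u) • D ℚ F u⁻¹ = -((c • u⁻¹) • D ℚ F u) := by
    rw [Derivation.leibniz_inv, smul_smul, ← neg_smul, smul_mul_assoc, ← smul_neg]
    congr 2
    field_simp
  have hσ_smul : σ (c • u⁻¹) = c • u := by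
    rw [Algebra.smul_def, map_mul, σ.commutes, map_inv₀, hσ, inv_inv, ← Algebra.smul_def]
  rw [hσ_smul, hσ, h_neg, map_neg, ← ha, σ.commutes] at h₂
  rw [← ha]
  exact self_eq_neg.1 h₂.symm

theorem map_inv_pow_smul_D (hΨ : IsEquivariant L Ψ) (htr : Algebra.trdeg L F = 1) (c : L)
    {u : F} (hu : Transcendental L u) (m : ℕ) : Ψ ((c • u⁻¹ ^ (m + 1)) • D ℚ F u) = 0 := by
  cases m with
  | zero => simpa using hΨ.map_inv_smul_D htr c hu
  | succ m =>
    have hu' : Transcendental L u⁻¹ := fun h => hu (by simpa using h.inv)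
    have h := hΨ.map_pow_smul_D htr (-c) hu' m
    rw [Derivation.leibniz_inv, smul_smul, smul_mul_assoc, neg_smul, ← smul_neg, mul_neg,
      neg_neg, ← pow_add] at h
    exact h

theorem map_smul_D_of_mem_adjoin (hΨ : IsEquivariant L Ψ) (htr : Algebra.trdeg L F = 1)
    {u f : F} (hu : Transcendental L u) (hf : f ∈ L⟮u⟯) : Ψ (f • D ℚ F u) = 0 := by
  let V : AddSubgroup F := (Ψ.comp ((AddMonoidHom.flip (smulAddHom F Ω[F⁄ℚ])) (D ℚ F u))).ker
  refine mem_of_mem_adjoin_simple (V := V) hu (hΨ.map_pow_smul_D htr · hu) (fun c a m => ?_) hf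
  change Ψ ((c • (u - algebraMap L F a)⁻¹ ^ (m + 1)) • D ℚ F u) = 0
  have hu' : Transcendental L (u - algebraMap L F a) := fun h => hu (by
    simpa using h.add (isAlgebraic_algebraMap a))
  conv_lhs => rw [← sub_add_cancel u (algebraMap L F a), map_add (D ℚ F)]
  rw [smul_add, map_add, hΨ.map_smul_D_algebraMap htr, add_zero, add_sub_cancel_right]
  exact hΨ.map_inv_pow_smul_D htr c hu' m

/-- If `Ψ (f • D u)` lies in `L(u)`, it vanishes: average over the conjugates of `f`. -/
theorem map_smul_D_eq_zero_of_mem (hΨ : IsEquivariant L Ψ) (htr : Algebra.trdeg L F = 1)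
    {u f : F} (hu : Transcendental L u) (hf : Ψ (f • D ℚ F u) ∈ L⟮u⟯) :
    Ψ (f • D ℚ F u) = 0 := by
  have h_alg := isAlgebraic_adjoin_of_trdeg_eq_one htr hu
  have h_int : IsIntegral L⟮u⟯ f := (h_alg.isAlgebraic f).isIntegral
  have : Normal L⟮u⟯ F := normal_iff.2 fun x =>
    ⟨(h_alg.isAlgebraic x).isIntegral, IsAlgClosed.splits _⟩
  set s := (minpoly L⟮u⟯ f).aroots F
  have h_conj : ∀ g ∈ s, Ψ (g • D ℚ F u) = Ψ (f • D ℚ F u) := fun g hg => by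
    obtain ⟨σ, hσ⟩ := minpoly.exists_algEquiv_of_root' (h_alg.isAlgebraic f) (mem_aroots.1 hg).2
    have h := hΨ (σ.restrictScalars L) f u
    simp only [AlgEquiv.restrictScalars_apply, hσ] at h
    rwa [show σ u = u from σ.commutes ⟨u, mem_adjoin_simple_self L u⟩,
      show σ (Ψ _) = _ from σ.commutes ⟨_, hf⟩] at h
  have h_sum : s.sum ∈ L⟮u⟯ := by
    have h := (IsAlgClosed.splits ((minpoly L⟮u⟯ f).map (algebraMap L⟮u⟯ F)))
      |>.nextCoeff_eq_neg_sum_roots_of_monic ((minpoly.monic h_int).map _)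
    rw [nextCoeff_map (algebraMap L⟮u⟯ F).injective] at h
    rw [← neg_neg s.sum, ← h]
    exact neg_mem (SetLike.coe_mem _)
  have h_card : (s.card : F) * Ψ (f • D ℚ F u) = 0 := by
    rw [← nsmul_eq_mul, ← Multiset.sum_replicate, ← Multiset.map_const',
      ← hΨ.map_smul_D_of_mem_adjoin htr hu h_sum, ← Multiset.map_congr rfl h_conj]
    exact (map_multiset_sum
      (Ψ.comp ((AddMonoidHom.flip (smulAddHom F Ω[F⁄ℚ])) (D ℚ F u))) s).symm
  refine (mul_eq_zero.1 h_card).resolve_left (Nat.cast_ne_zero.2 ?_)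
  rw [IsAlgClosed.card_aroots_eq_natDegree]
  exact (minpoly.natDegree_pos h_int).ne'

/-- In transcendence degree one, every equivariant map `Ω[F⁄ℚ] → F` vanishes. -/
theorem eq_zero (hΨ : IsEquivariant L Ψ) (htr : Algebra.trdeg L F = 1) : Ψ = 0 := by
  ext ω
  obtain ⟨u, hu, h_mem⟩ : ∃ u, Transcendental L u ∧ Ψ ω ∈ L⟮u⟯ := by
    by_cases h : Ψ ω ∈ (algebraMap L F).range
    · obtain ⟨u, hu⟩ := (trdeg_ne_zero_iff.1 (htr.trans_ne one_ne_zero)).transcendental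
      obtain ⟨c, hc⟩ := h
      exact ⟨u, hu, hc ▸ IntermediateField.algebraMap_mem _ c⟩
    · exact ⟨Ψ ω, transcendental_of_notMem_range_s18 h, mem_adjoin_simple_self L _⟩
  have := isAlgebraic_adjoin_of_trdeg_eq_one htr hu
  have hω : ω ∈ Submodule.span F (insert (D ℚ F u)
      (Set.range fun a : L => D ℚ F (algebraMap L F a))) := by
    rw [span_insert_D_eq_top]; trivial
  obtain ⟨f, η, hη, rfl⟩ := Submodule.mem_span_insert.1 hω
  have hη_zero : Ψ η = 0 := by
    clear h_mem hω
    induction hη using Submodule.closure_induction with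
    | zero => exact map_zero Ψ
    | add x y _ _ hx hy => rw [map_add, hx, hy, add_zero]
    | smul_mem r x hx =>
      obtain ⟨a, rfl⟩ := hx
      exact hΨ.map_smul_D_algebraMap htr r a
  rw [map_add, hη_zero, add_zero] at h_mem ⊢
  exact hΨ.map_smul_D_eq_zero_of_mem htr hu h_mem

end IsEquivariant

end TrdegOne

section Trdeg

open AlgebraicIndependent (matroid)

open scoped IntermediateField.algebraAdjoinAdjoin in
theorem mem_algebraicClosure_adjoin_iff {k F : Type*} [Field k] [Field F] [Algebra k F]
    {s : Set F} {z : F} : z ∈ algebraicClosure (IntermediateField.adjoin k s) F ↔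
      z ∈ (matroid k F).closure s := by
  rw [AlgebraicIndependent.matroid_closure_eq, SetLike.mem_coe,
    Subalgebra.mem_algebraicClosure, mem_algebraicClosure_iff]
  exact (IsFractionRing.isAlgebraic_iff (Algebra.adjoin k s) (IntermediateField.adjoin k s) F).symm

/-- If `trdeg F/k = m + 1`, then any `m` elements of `F` lie in an algebraically closed subfield
of codimension one. -/
theorem exists_intermediateField_trdeg_eq_one {k F : Type*} [Field k] [Field F] [Algebra k F]
    [IsAlgClosed F] {m : ℕ} (htr : Algebra.trdeg k F = m + 1) (y : Fin m → F) :
    ∃ L : IntermediateField k F, IsAlgClosed L ∧ Algebra.trdeg L F = 1 ∧ ∀ i, y i ∈ L := by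
  obtain ⟨I, hI⟩ := (matroid k F).exists_isBasis (Set.range y)
  obtain ⟨B, hB, hIB⟩ := hI.indep.exists_isBase_superset
  have hB_card : Cardinal.mk B = m + 1 := by
    rw [hB.cardinalMk_eq_cRank, AlgebraicIndependent.matroid_cRank_eq, htr]
  have hI_card : Cardinal.mk I ≤ m := by
    refine (Cardinal.mk_le_mk_of_subset hI.subset).trans ?_
    simpa using Cardinal.mk_range_le_lift (f := y)
  obtain ⟨b, hbB, hbI⟩ : ∃ b ∈ B, b ∉ I := by
    by_contra! h
    have := (Cardinal.mk_le_mk_of_subset h).trans hI_card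
    rw [hB_card] at this
    norm_cast at this
    omega
  let L := (algebraicClosure (IntermediateField.adjoin k (B \ {b})) F).restrictScalars k
  have mem_L {z : F} : z ∈ L ↔ z ∈ (matroid k F).closure (B \ {b}) :=
    mem_algebraicClosure_adjoin_iff
  have hL : IsAlgClosed L :=
    (algebraicClosure.isAlgClosure (IntermediateField.adjoin k (B \ {b})) F).isAlgClosed
  have hC : B \ {b} ⊆ L := fun z hz => mem_L.2 ((matroid k F).mem_closure_of_mem hz)
  have h_le : (m : Cardinal) ≤ Algebra.trdeg k L := by
    have h_ind := AlgebraicIndependent.matroid_indep_iff.1 (hB.indep.sdiff {b})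
    have h : AlgebraicIndependent k (Set.inclusion hC) := .of_comp L.val h_ind
    refine le_trans ?_ h.cardinalMk_le_trdeg
    have := Cardinal.mk_sdiff_add_mk (Set.singleton_subset_iff.2 hbB)
    rw [hB_card, Cardinal.mk_singleton] at this
    exact (Cardinal.add_one_inj.1 this).ge
  have h_add : Algebra.trdeg k L + Algebra.trdeg L F = m + 1 := by
    rw [trdeg_add_eq, htr]
  have hb : b ∉ (algebraMap L F).range := by
    rintro ⟨c, hc⟩
    exact hB.indep.notMem_closure_sdiff_of_mem hbB (mem_L.1 (hc ▸ c.2))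
  have h_ne : Algebra.trdeg L F ≠ 0 :=
    trdeg_ne_zero_iff.2 ⟨b, transcendental_of_notMem_range_s18 hb⟩
  refine ⟨L, hL, ?_, fun i => ?_⟩
  · have h_fin : (m + 1 : Cardinal) < Cardinal.aleph0 := by
      exact_mod_cast Cardinal.natCast_lt_aleph0 (n := m + 1)
    rw [← h_add, Cardinal.add_lt_aleph0_iff] at h_fin
    obtain ⟨a, ha⟩ := Cardinal.lt_aleph0.1 h_fin.1
    obtain ⟨c, hc⟩ := Cardinal.lt_aleph0.1 h_fin.2
    rw [ha] at h_le h_add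
    rw [hc] at h_add h_ne ⊢
    norm_cast at *
    omega
  · exact mem_L.2 ((matroid k F).closure_subset_closure
      (Set.subset_sdiff_singleton hIB hbI) (hI.subset_closure ⟨i, rfl⟩))

end Trdeg

/-- Let `F/k` be of finite transcendence degree `n ≥ 1`, and let `Ω^n_F` be the
`n`-th exterior power (over `F`) of the module of absolute Kähler differentials
of `F` (i.e. over `ℚ`).  For the natural action `ρ` of `G = Aut(F/k)` on `Ω^n_F`
(characterized by `σ(f₀ df₁ ∧ … ∧ df_n) = σ(f₀) dσ(f₁) ∧ … ∧ dσ(f_n)`), every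
`G`-equivariant additive (equivalently, `ℚ`-linear) map `Ω^n_F → F` is zero. -/
theorem statement18 (k F : Type*) [Field k] [Field F] [Algebra k F]
    [IsAlgClosed k] [IsAlgClosed F] [CharZero k] [CharZero F]
    (n : ℕ) (hn : 1 ≤ n) (hb : ∃ x : Fin n → F, IsTranscendenceBasis k x)
    (ρ : (F ≃ₐ[k] F) → (↥(⋀[F]^n (Ω[F⁄ℚ])) →+ ↥(⋀[F]^n (Ω[F⁄ℚ]))))
    (hρ : ∀ (σ : F ≃ₐ[k] F) (f₀ : F) (f : Fin n → F),
      ρ σ (f₀ • wedge F (Ω[F⁄ℚ]) n (fun i => KaehlerDifferential.D ℚ F (f i))) =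
        σ f₀ • wedge F (Ω[F⁄ℚ]) n (fun i => KaehlerDifferential.D ℚ F (σ (f i))))
    (φ : ↥(⋀[F]^n (Ω[F⁄ℚ])) →+ F)
    (hφ : ∀ (σ : F ≃ₐ[k] F) (ω : ↥(⋀[F]^n (Ω[F⁄ℚ]))), φ (ρ σ ω) = σ (φ ω)) :
    φ = 0 := by
  obtain ⟨m, rfl⟩ := Nat.exists_eq_add_of_le' hn
  obtain ⟨x, hx⟩ := hb
  have htr : Algebra.trdeg k F = m + 1 := by
    simpa using hx.lift_cardinalMk_eq_trdeg.symm
  have h_gen (f : F) (y : Fin (m + 1) → F) :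
      φ (f • exteriorPower.ιMulti F (m + 1) fun i => KaehlerDifferential.D ℚ F (y i)) = 0 := by
    obtain ⟨L, hL, hL_tr, hyL⟩ := exists_intermediateField_trdeg_eq_one htr (Fin.tail y)
    let θ : Ω[F⁄ℚ] →ₗ[F] ⋀[F]^(m + 1) Ω[F⁄ℚ] :=
      (exteriorPower.ιMulti F (m + 1)).toMultilinearMap.toLinearMap
        (fun i => KaehlerDifferential.D ℚ F (y i)) 0
    have hθ (g z : F) : θ (g • KaehlerDifferential.D ℚ F z) =
        g • wedge F (Ω[F⁄ℚ]) (m + 1)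
          (fun i => KaehlerDifferential.D ℚ F (Function.update y 0 z i)) := by
      rw [map_smul]
      congr 1
      refine congrArg (exteriorPower.ιMulti F (m + 1)) (funext fun i => ?_)
      exact (Function.apply_update (fun _ => KaehlerDifferential.D ℚ F) y 0 z i).symm
    have hΨ : IsEquivariant L (φ.comp θ.toAddMonoidHom) := fun σ g z => by
      have h := hφ (σ.restrictScalars k) (θ (g • KaehlerDifferential.D ℚ F z))
      rw [hθ, hρ, ← hθ] at h
      refine Eq.trans (congrArg φ ((hθ _ _).trans ?_)) h
      refine congrArg (fun v => σ g • wedge F _ (m + 1) v) (funext fun i => ?_)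
      refine i.cases rfl fun j => ?_
      exact congrArg _ (σ.commutes ⟨y j.succ, hyL j⟩).symm
    have h := DFunLike.congr_fun (hΨ.eq_zero hL_tr) (f • KaehlerDifferential.D ℚ F (y 0))
    change φ (θ _) = 0 at h
    rwa [hθ, Function.update_eq_self] at h
  ext ω
  have hω : ω ∈ Submodule.span F (exteriorPower.ιMulti F (m + 1) ''
      {a | Set.range a ⊆ Set.range (KaehlerDifferential.D ℚ F)}) := by
    rw [exteriorPower.ιMulti_span_of_span F (m + 1) _
      (KaehlerDifferential.span_range_derivation ℚ F)]
    trivial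
  induction hω using Submodule.closure_induction with
  | zero => exact map_zero φ
  | add x y _ _ hx hy => rw [map_add, hx, hy, map_add]
  | smul_mem r x hx =>
    obtain ⟨a, ha, rfl⟩ := hx
    choose y hy using fun i => ha ⟨i, rfl⟩
    rw [← funext hy]
    exact h_gen r y
end
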